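/- Let μ ∈ P be an integral weight and m ∈ ℤ_{≥1}. The dilation map Θ_m : B(μ) → B(mμ), π ↦ mπ, satisfies: Θ_m(π_μ) = π_{mμ}; wt(Θ_m(π)) = m·wt(π) for all π ∈ B(μ); Θ_m(ẽ_iπ) = ẽ_i^mΘ_m(π) and Θ_m(f̃_iπ) = f̃_i^mΘ_m(π) for all π ∈ B(μ) and i ∈ I (with the convention Θ_m(0) = 0); and ε_i(Θ_m(π)) = m·ε_i(π), φ_i(Θ_m(π)) = m·φ_i(π) for all π ∈ B(μ) and i ∈ I. -/

import Mathlib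

open scoped Classical
noncomputable section

namespace LSPaper

/-- The clamp of a real number to the interval `[0,1]`; paths `[0,1] → V` are
encoded as functions `ℝ → V` that factor through this clamp. -/
def clamp01 (t : ℝ) : ℝ := max 0 (min 1 t)

variable {V : Type*} [AddCommGroup V] [Module ℝ V]

/-- The straight-line path `π_ν(t) = t ν` (clamped outside `[0,1]`). -/
def straight (ν : V) : ℝ → V := fun t => clamp01 t • ν

/-- The dilation `(mπ)(t) = m • π(t)`. -/
def dilate (m : ℕ) (f : ℝ → V) : ℝ → V := fun t => (m : ℝ) • f t

/-- The concatenation `π_1 * ⋯ * π_m` of a list of paths: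
`(π_1 * ⋯ * π_m)(t) = Σ_{l<k} π_l(1) + π_k(mt - k + 1)` for
`(k-1)/m ≤ t ≤ k/m`. -/
def concatList (l : List (ℝ → V)) : ℝ → V := fun t =>
  let m := l.length
  let k : ℕ := max 1 (min m (⌈(m : ℝ) * t⌉.toNat))
  (((l.take (k - 1)).map fun f => f 1).sum) +
    (l.getD (k - 1) 0) ((m : ℝ) * t - ((k : ℝ) - 1))

/-- Subdivision of a path into `m` pieces:
`π_k(t) = π(t/m + (k-1)/m) - π((k-1)/m)` (here `k` runs over `0, …, m-1`). -/
def subdiv (m : ℕ) (f : ℝ → V) : List (ℝ → V) :=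
  List.ofFn fun k : Fin m => fun t : ℝ =>
    f ((clamp01 t + (k : ℝ)) / m) - f ((k : ℝ) / m)

/-- The map `Σ_m : B(μ) → B(μ)^{⊗m}` (tensor factors encoded as a list):
dilate by `m`, then subdivide into `m` pieces. -/
def SigmaMap (m : ℕ) (f : ℝ → V) : List (ℝ → V) := subdiv m (dilate m f)

/-- The weight of a tensor product (encoded as a list of paths): the sum of
the weights of the factors. -/
def tensWt (l : List (ℝ → V)) : V := (l.map fun f => f 1).sum

/-- A symmetrizable generalized Cartan matrix together with a realization:
an integral weight lattice `P` inside a real vector space `V`, linearly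
independent simple roots `α i ∈ P` and simple coroots (as linear functionals)
with `⟨α j, α i∨⟩ = a i j`, taking integer values on `P`. -/
structure KacMoodyData (I : Type*) (V : Type*) [Fintype I] [DecidableEq I]
    [AddCommGroup V] [Module ℝ V] where
  a : I → I → ℤ
  d : I → ℤ
  P : AddSubgroup V
  α : I → V
  coroot : I → V →ₗ[ℝ] ℝ
  diag : ∀ i, a i i = 2
  offDiag : ∀ i j, i ≠ j → a i j ≤ 0
  zeroIff : ∀ i j, a i j = 0 ↔ a j i = 0
  dPos : ∀ i, 0 < d i
  symmetrizable : ∀ i j, d i * a i j = d j * a j i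
  cartanPairing : ∀ i j, coroot i (α j) = (a i j : ℝ)
  rootsIndep : LinearIndependent ℝ α
  corootsIndep : LinearIndependent ℝ coroot
  rootMem : ∀ i, α i ∈ P
  pairingInt : ∀ i, ∀ v ∈ P, ∃ n : ℤ, coroot i v = (n : ℝ)
  latticeFree : ∃ n : ℕ, Nonempty (P ≃+ (Fin n → ℤ))

namespace KacMoodyData

variable {I : Type*} [Fintype I] [DecidableEq I]
variable (K : KacMoodyData I V)

/-- The simple reflection `r_i(x) = x - ⟨x, α_i∨⟩ α_i` as a linear map. -/
def reflMap (i : I) : V →ₗ[ℝ] V := LinearMap.id - (K.coroot i).smulRight (K.α i)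

lemma reflMap_invol (i : I) : Function.Involutive (K.reflMap i) := by
  intro x
  have h2 : K.coroot i (K.α i) = 2 := by
    have h := K.cartanPairing i i
    rw [K.diag i] at h
    simpa using h
  simp only [reflMap, LinearMap.sub_apply, LinearMap.id_apply, LinearMap.smulRight_apply,
    map_sub, map_smul, smul_eq_mul, h2]
  module

/-- The simple reflection `r_i` as a linear automorphism of `V`. -/
def refl (i : I) : V ≃ₗ[ℝ] V :=
  { K.reflMap i with
    invFun := K.reflMap i
    left_inv := K.reflMap_invol i
    right_inv := K.reflMap_invol i }

/-- The Weyl group `W`, generated by the simple reflections. -/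
def weylGroup : Subgroup (V ≃ₗ[ℝ] V) := Subgroup.closure (Set.range K.refl)

/-- The Weyl group orbit `W μ` of an integral weight. -/
def orbit (μ : V) : Set V := {ν | ∃ w ∈ K.weylGroup, ν = w μ}

/-- `Q_+ = Σ_i ℤ_{≥0} α_i`. -/
def Qplus : Set V := {v | ∃ c : I → ℕ, v = ∑ i, (c i : ℝ) • K.α i}

/-- One step of the order on a Weyl group orbit:  `ν' = r_β(ν)` for a positive
real root `β = w α_i ∈ Q_+` (with `β∨ = w α_i∨`, `r_β = w r_i w⁻¹`) such that
`⟨ν, β∨⟩ < 0`. -/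
def StepDown (ν ν' : V) : Prop :=
  ∃ w ∈ K.weylGroup, ∃ i : I, w (K.α i) ∈ K.Qplus ∧
    K.coroot i (w.symm ν) < 0 ∧ ν' = w (K.refl i (w.symm ν))

/-- There is a chain `ν = ξ_0, ξ_1, …, ξ_p = ν'` of steps down. -/
def chainLen (p : ℕ) (ν ν' : V) : Prop :=
  ∃ ξ : ℕ → V, ξ 0 = ν ∧ ξ p = ν' ∧ ∀ q < p, K.StepDown (ξ q) (ξ (q + 1))

/-- `dist(ν, ν')`: the maximal length of a chain from `ν` down to `ν'`. -/
def dist (ν ν' : V) : ℕ := sSup {p | K.chainLen p ν ν'}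

/-- A `σ`-chain for `(ν, ν')`: a sequence `ν = ξ_0 > ξ_1 > ⋯ > ξ_p = ν'` with
`dist(ξ_{q-1}, ξ_q) = 1` and `σ ⟨ξ_{q-1}, β_q∨⟩ ∈ ℤ_{<0}`, where `β_q` is the
positive real root with `ξ_q = r_{β_q} ξ_{q-1}`. -/
def SigmaChain (σ : ℚ) (ν ν' : V) : Prop :=
  ∃ p : ℕ, 0 < p ∧ ∃ ξ : ℕ → V, ξ 0 = ν ∧ ξ p = ν' ∧
    ∀ q < p, K.dist (ξ q) (ξ (q + 1)) = 1 ∧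
      ∃ w ∈ K.weylGroup, ∃ i : I, w (K.α i) ∈ K.Qplus ∧
        ξ (q + 1) = w (K.refl i (w.symm (ξ q))) ∧
        ∃ n : ℤ, n < 0 ∧ (σ : ℝ) * K.coroot i (w.symm (ξ q)) = (n : ℝ)

/-- The combinatorial datum of a Lakshmibai–Seshadri path of shape `μ`:
a strictly decreasing sequence `ν_1 > ν_2 > ⋯ > ν_s` in `W μ` together with
rationals `0 = σ_0 < σ_1 < ⋯ < σ_s = 1` admitting `σ_u`-chains (the `ν`'s are
indexed here by `Fin s`, i.e. `0, …, s-1`). -/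
structure LSData (K : KacMoodyData I V) (μ : V) where
  s : ℕ
  spos : 0 < s
  ν : Fin s → V
  τ : Fin (s + 1) → ℚ
  mem : ∀ u, ν u ∈ K.orbit μ
  strictDec : ∀ (u : ℕ) (h : u + 1 < s),
    Relation.TransGen K.StepDown (ν ⟨u, Nat.lt_of_succ_lt h⟩) (ν ⟨u + 1, h⟩)
  τ_zero : τ 0 = 0
  τ_last : τ (Fin.last s) = 1
  τ_mono : StrictMono τ
  chainCond : ∀ (u : ℕ) (h : u + 1 < s),
    K.SigmaChain (τ ⟨u + 1, Nat.lt_succ_of_lt h⟩) (ν ⟨u, Nat.lt_of_succ_lt h⟩) (ν ⟨u + 1, h⟩)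

/-- The piecewise-linear path `[0,1] → ℝ ⊗ P` associated with an LS datum:
`π(t) = Σ_{k<u} (σ_k - σ_{k-1}) ν_k + (t - σ_{u-1}) ν_u` for `σ_{u-1} ≤ t ≤ σ_u`,
encoded as the function `ℝ → V`, `t ↦ Σ_k (min t σ_{k+1} - min t σ_k) • ν_k`
(which is constant for `t ≤ 0` and `t ≥ 1`). -/
def LSData.path {K : KacMoodyData I V} {μ : V} (π : K.LSData μ) : ℝ → V := fun t =>
  ∑ k : Fin π.s,
    ((min t ((π.τ k.succ : ℚ) : ℝ)) - (min t ((π.τ k.castSucc : ℚ) : ℝ))) • π.ν k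

/-- `B(μ)`: the set of Lakshmibai–Seshadri paths of shape `μ`. -/
def B (μ : V) : Set (ℝ → V) := {f | ∃ π : K.LSData μ, f = π.path}

/-- `H_i^π(t) = ⟨π(t), α_i∨⟩`. -/
def H (i : I) (f : ℝ → V) : ℝ → ℝ := fun t => K.coroot i (f t)

/-- `m_i^π = min {H_i^π(t) : t ∈ [0,1]}`. -/
def mval (i : I) (f : ℝ → V) : ℝ := sInf (K.H i f '' Set.Icc 0 1)

/-- The raising root operator `ẽ_i` (the underlying path, before testing
whether it is defined): with `t_1 = min {t : H_i^π(t) = m_i^π}` and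
`t_0 = max {t ≤ t_1 : H_i^π(t) = m_i^π + 1}`, the new path is `π(t)` for
`t ≤ t_0`, `r_i(π(t) - π(t_0)) + π(t_0)` for `t_0 ≤ t ≤ t_1` and `π(t) + α_i`
for `t ≥ t_1`. -/
def eraw (i : I) (f : ℝ → V) : ℝ → V := fun t =>
  let m := K.mval i f
  let t1 := sInf {t | t ∈ Set.Icc (0 : ℝ) 1 ∧ K.H i f t = m}
  let t0 := sSup {t | t ∈ Set.Icc (0 : ℝ) t1 ∧ K.H i f t = m + 1}
  if t ≤ t0 then f t
  else if t ≤ t1 then K.refl i (f t - f t0) + f t0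
  else f t + K.α i

/-- The lowering root operator `f̃_i` (the underlying path): with
`t_0 = max {t : H_i^π(t) = m_i^π}` and `t_1 = min {t ≥ t_0 : H_i^π(t) = m_i^π + 1}`,
the new path is `π(t)` for `t ≤ t_0`, `r_i(π(t) - π(t_0)) + π(t_0)` for
`t_0 ≤ t ≤ t_1` and `π(t) - α_i` for `t ≥ t_1`. -/
def fraw (i : I) (f : ℝ → V) : ℝ → V := fun t =>
  let m := K.mval i f
  let t0 := sSup {t | t ∈ Set.Icc (0 : ℝ) 1 ∧ K.H i f t = m}
  let t1 := sInf {t | t ∈ Set.Icc t0 1 ∧ K.H i f t = m + 1}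
  if t ≤ t0 then f t
  else if t ≤ t1 then K.refl i (f t - f t0) + f t0
  else f t - K.α i

/-- The root operator `ẽ_i`, with value `none` (the formal element `0`) when
`m_i^π = 0`. -/
def eop (i : I) (f : ℝ → V) : Option (ℝ → V) :=
  if K.mval i f = 0 then none else some (K.eraw i f)

/-- The root operator `f̃_i`, with value `none` (the formal element `0`) when
`H_i^π(1) - m_i^π = 0`. -/
def fop (i : I) (f : ℝ → V) : Option (ℝ → V) :=
  if K.H i f 1 - K.mval i f = 0 then none else some (K.fraw i f)

/-- `ẽ_i^n π` (with `ẽ_i 0 = 0`). -/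
def eIter (i : I) (n : ℕ) (f : ℝ → V) : Option (ℝ → V) :=
  (fun o => o.bind (K.eop i))^[n] (some f)

/-- `f̃_i^n π` (with `f̃_i 0 = 0`). -/
def fIter (i : I) (n : ℕ) (f : ℝ → V) : Option (ℝ → V) :=
  (fun o => o.bind (K.fop i))^[n] (some f)

/-- `ε_i(π) = max {n ≥ 0 : ẽ_i^n π ≠ 0}`. -/
def epsilon (i : I) (f : ℝ → V) : ℕ := sSup {n | K.eIter i n f ≠ none}

/-- `φ_i(π) = max {n ≥ 0 : f̃_i^n π ≠ 0}`. -/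
def phi (i : I) (f : ℝ → V) : ℕ := sSup {n | K.fIter i n f ≠ none}

/-- The Weyl group action on a normal crystal:
`S_i b = f̃_i^{⟨wt b, α_i∨⟩} b` if `⟨wt b, α_i∨⟩ ≥ 0` and
`S_i b = ẽ_i^{-⟨wt b, α_i∨⟩} b` if `⟨wt b, α_i∨⟩ ≤ 0`. -/
def Sop (i : I) (f : ℝ → V) : Option (ℝ → V) :=
  if 0 ≤ K.coroot i (f 1) then K.fIter i (⌊K.coroot i (f 1)⌋.toNat) f
  else K.eIter i ((-⌊K.coroot i (f 1)⌋).toNat) f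

/-- `SWord K [i₁, …, i_k] b = S_{i₁} S_{i₂} ⋯ S_{i_k} b`. -/
def SWord (K : KacMoodyData I V) : List I → Option (ℝ → V) → Option (ℝ → V)
  | [], o => o
  | i :: rest, o => (SWord K rest o).bind (K.Sop i)

/-- `b` is extremal: for each `w ∈ W` (as a word in simple reflections) and
`i ∈ I`, `ẽ_i (S_w b) = 0` if `⟨wt (S_w b), α_i∨⟩ ≥ 0` and `f̃_i (S_w b) = 0`
if `⟨wt (S_w b), α_i∨⟩ ≤ 0`. -/
def Extremal (f : ℝ → V) : Prop :=
  ∀ (l : List I) (g : ℝ → V), K.SWord l (some f) = some g →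
    ∀ i : I, (0 ≤ K.coroot i (g 1) → K.eop i g = none) ∧
      (K.coroot i (g 1) ≤ 0 → K.fop i g = none)

/-- Application of a word in the Kashiwara operators (`true` stands for `ẽ`,
`false` for `f̃`), leftmost entry applied first. -/
def applyWord (K : KacMoodyData I V) :
    List (I × Bool) → Option (ℝ → V) → Option (ℝ → V)
  | [], o => o
  | p :: rest, o =>
      applyWord K rest (o.bind fun f => if p.2 then K.eop p.1 f else K.fop p.1 f)

/-- `B(μ)^{*m}`: the set of `m`-fold concatenations of LS paths of shape `μ`. -/
def ConcatSet (μ : V) (m : ℕ) : Set (ℝ → V) :=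
  {g | ∃ l : List (ℝ → V), l.length = m ∧ (∀ f ∈ l, f ∈ K.B μ) ∧ g = concatList l}

/-- `ε_i` of a tensor product (encoded as a list of paths, Kashiwara's rule):
`ε_i(b₁ ⊗ b₂) = max (ε_i b₁) (ε_i b₂ - ⟨wt b₁, α_i∨⟩)`. -/
def tensEps (K : KacMoodyData I V) (i : I) : List (ℝ → V) → ℤ
  | [] => 0
  | [b] => (K.epsilon i b : ℤ)
  | b :: c :: rest =>
      max ((K.epsilon i b : ℤ)) (tensEps K i (c :: rest) - ⌊K.coroot i (b 1)⌋)

/-- `φ_i` of a tensor product (Kashiwara's rule):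
`φ_i(b₁ ⊗ b₂) = max (φ_i b₂) (φ_i b₁ + ⟨wt b₂, α_i∨⟩)`. -/
def tensPhi (K : KacMoodyData I V) (i : I) : List (ℝ → V) → ℤ
  | [] => 0
  | [b] => (K.phi i b : ℤ)
  | b :: c :: rest =>
      max (tensPhi K i (c :: rest)) ((K.phi i b : ℤ) + ⌊K.coroot i (tensWt (c :: rest))⌋)

/-- `ẽ_i` on a tensor product (Kashiwara's rule):
`ẽ_i(b₁ ⊗ b₂) = (ẽ_i b₁) ⊗ b₂` if `φ_i(b₁) ≥ ε_i(b₂)`, else `b₁ ⊗ (ẽ_i b₂)`. -/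
def tensE (K : KacMoodyData I V) (i : I) : List (ℝ → V) → Option (List (ℝ → V))
  | [] => none
  | [b] => (K.eop i b).map fun b' => [b']
  | b :: c :: rest =>
      if K.tensEps i (c :: rest) ≤ (K.phi i b : ℤ) then
        (K.eop i b).map fun b' => b' :: c :: rest
      else (tensE K i (c :: rest)).map fun r' => b :: r'

/-- `f̃_i` on a tensor product (Kashiwara's rule):
`f̃_i(b₁ ⊗ b₂) = (f̃_i b₁) ⊗ b₂` if `φ_i(b₁) > ε_i(b₂)`, else `b₁ ⊗ (f̃_i b₂)`. -/
def tensF (K : KacMoodyData I V) (i : I) : List (ℝ → V) → Option (List (ℝ → V))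
  | [] => none
  | [b] => (K.fop i b).map fun b' => [b']
  | b :: c :: rest =>
      if K.tensEps i (c :: rest) < (K.phi i b : ℤ) then
        (K.fop i b).map fun b' => b' :: c :: rest
      else (tensF K i (c :: rest)).map fun r' => b :: r'

/-- `ẽ_i^n` on tensor products. -/
def tensEIter (i : I) (n : ℕ) (l : List (ℝ → V)) : Option (List (ℝ → V)) :=
  (fun o => o.bind (K.tensE i))^[n] (some l)

/-- `f̃_i^n` on tensor products. -/
def tensFIter (i : I) (n : ℕ) (l : List (ℝ → V)) : Option (List (ℝ → V)) :=
  (fun o => o.bind (K.tensF i))^[n] (some l)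

end KacMoodyData

end LSPaper

namespace LSPaper

namespace KacMoodyData

/-- The word of length `n` alternating between `i` and `j` and ending with `j`. -/
def altWord {I : Type*} (i j : I) : ℕ → List I
  | 0 => []
  | n + 1 => (if Even n then j else i) :: altWord i j n

lemma mem_altWord {I : Type*} (i j : I) (n : ℕ) : ∀ x ∈ altWord i j n, x = i ∨ x = j := by
  induction n with
  | zero => simp [altWord]
  | succ n ih =>
    intro x hx
    rw [altWord, List.mem_cons] at hx
    rcases hx with rfl | hx
    · split_ifs <;> simp
    · exact ih x hx

lemma length_altWord {I : Type*} (i j : I) (n : ℕ) : (altWord i j n).length = n := by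
  induction n with
  | zero => rfl
  | succ n ih => simp [altWord, ih]

variable {I V : Type*} [Fintype I] [DecidableEq I] [AddCommGroup V] [Module ℝ V]
  (K : KacMoodyData I V)

lemma refl_apply (i : I) (x : V) : K.refl i x = x - K.coroot i x • K.α i := rfl

lemma coroot_self (i : I) : K.coroot i (K.α i) = 2 := by
  rw [K.cartanPairing, K.diag]; norm_num

lemma refl_refl (i : I) (x : V) : K.refl i (K.refl i x) = x := K.reflMap_invol i x

lemma refl_mul_self (i : I) : K.refl i * K.refl i = 1 :=
  LinearEquiv.ext fun x => K.refl_refl i x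

lemma refl_inv (i : I) : (K.refl i)⁻¹ = K.refl i :=
  inv_eq_of_mul_eq_one_left (K.refl_mul_self i)

lemma refl_mem (i : I) : K.refl i ∈ K.weylGroup := Subgroup.subset_closure ⟨i, rfl⟩

lemma refl_root (i : I) : K.refl i (K.α i) = -K.α i := by
  rw [refl_apply, coroot_self]; module

lemma coroot_refl_self (i : I) (x : V) : K.coroot i (K.refl i x) = -K.coroot i x := by
  rw [refl_apply, map_sub, map_smul, coroot_self, smul_eq_mul]; ring

/-- The Weyl group element given by a word in the simple reflections. -/
def wordProd (l : List I) : V ≃ₗ[ℝ] V := (l.map K.refl).prod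

@[simp] lemma wordProd_nil : K.wordProd [] = 1 := rfl

@[simp] lemma wordProd_cons (i : I) (l : List I) :
    K.wordProd (i :: l) = K.refl i * K.wordProd l := rfl

@[simp] lemma wordProd_append (l l' : List I) :
    K.wordProd (l ++ l') = K.wordProd l * K.wordProd l' := by simp [wordProd]

lemma exists_word {w : V ≃ₗ[ℝ] V} (hw : w ∈ K.weylGroup) : ∃ l, K.wordProd l = w := by
  induction hw using Subgroup.closure_induction with
  | mem x hx => obtain ⟨i, rfl⟩ := hx; exact ⟨[i], by simp⟩
  | one => exact ⟨[], rfl⟩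
  | mul x y _ _ hx hy =>
    obtain ⟨l, rfl⟩ := hx
    obtain ⟨l', rfl⟩ := hy
    exact ⟨l ++ l', by simp⟩
  | inv x _ hx =>
    obtain ⟨l, rfl⟩ := hx
    refine ⟨l.reverse, ?_⟩
    simp only [wordProd, List.prod_inv_reverse, List.map_reverse, List.map_map]
    congr 3

/-- The coefficients of the image of `α i` under `altWord i j n`, where `a = -a i j` and
`b = -a j i`. -/
def altCoeff (a b : ℤ) : ℕ → ℤ × ℤ
  | 0 => (1, 0)
  | n + 1 => if Even n then ((altCoeff a b n).1, b * (altCoeff a b n).1 - (altCoeff a b n).2)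
      else (a * (altCoeff a b n).2 - (altCoeff a b n).1, (altCoeff a b n).2)

lemma altCoeff_nonneg {a b : ℤ} (ha : 0 < a) (hb : 0 < b) (hab : 4 ≤ a * b) (n : ℕ) :
    0 ≤ (altCoeff a b n).1 ∧ 0 ≤ (altCoeff a b n).2 ∧
      (Even n → 2 * (altCoeff a b n).2 ≤ b * (altCoeff a b n).1) ∧
      (¬ Even n → 2 * (altCoeff a b n).1 ≤ a * (altCoeff a b n).2) := by
  induction n with
  | zero => simp [altCoeff, hb.le]
  | succ n ih =>
    obtain ⟨hp, hq, he, ho⟩ := ih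
    set p := (altCoeff a b n).1
    set q := (altCoeff a b n).2
    by_cases h : Even n
    · have h1 := he h
      have h2 : altCoeff a b (n + 1) = (p, b * p - q) := by simp [altCoeff, h, p, q]
      rw [h2]
      refine ⟨hp, by linarith, fun h' => absurd h' (by simp [h, parity_simps]), fun _ => ?_⟩
      simp only
      nlinarith [mul_le_mul_of_nonneg_left h1 ha.le, mul_le_mul_of_nonneg_right hab hp]
    · have h1 := ho h
      have h2 : altCoeff a b (n + 1) = (a * q - p, q) := by simp [altCoeff, h, p, q]
      rw [h2]
      refine ⟨by linarith, hq, fun _ => ?_, fun h' => absurd (by simp [h, parity_simps]) h'⟩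
      simp only
      nlinarith [mul_le_mul_of_nonneg_left h1 hb.le, mul_le_mul_of_nonneg_right hab hq]

lemma wordProd_altWord_root (i j : I) (n : ℕ) :
    K.wordProd (altWord i j n) (K.α i) =
      ((altCoeff (-K.a i j) (-K.a j i) n).1 : ℝ) • K.α i +
      ((altCoeff (-K.a i j) (-K.a j i) n).2 : ℝ) • K.α j := by
  induction n with
  | zero => simp [altWord, altCoeff]
  | succ n ih =>
    simp only [altWord, wordProd_cons, LinearEquiv.mul_apply, ih, altCoeff]
    split_ifs <;>
    · simp only [refl_apply, map_add, map_smul, K.cartanPairing, K.diag]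
      push_cast
      module

/-- The word `u` followed by `i` can be rewritten as a word in `i`, `j` shorter than `u`. -/
def Shortens (i j : I) (u : List I) : Prop :=
  ∃ u' : List I, (∀ x ∈ u', x = i ∨ x = j) ∧ K.wordProd u' = K.wordProd u * K.refl i ∧
    u'.length < u.length

variable {K} in
lemma Shortens.cons {i j : I} {u : List I} (h : K.Shortens i j u) {x : I} (hx : x = i ∨ x = j) :
    K.Shortens i j (x :: u) := by
  obtain ⟨u', h1, h2, h3⟩ := h
  exact ⟨x :: u', by simpa [hx] using h1, by simp [h2, mul_assoc], by simpa using h3⟩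

lemma eq_altWord_or_shortens {i j : I} (u : List I) (hu : ∀ x ∈ u, x = i ∨ x = j) :
    (∃ n, u = altWord i j n) ∨ K.Shortens i j u := by
  induction u with
  | nil => exact Or.inl ⟨0, rfl⟩
  | cons x u ih =>
    have hx := hu x (by simp)
    rcases ih fun y hy => hu y (by simp [hy]) with ⟨n, rfl⟩ | h
    · by_cases hn : x = if Even n then j else i
      · exact Or.inl ⟨n + 1, by rw [altWord, ← hn]⟩
      right
      cases n with
      | zero =>
        have : x = i := hx.resolve_right (by simpa using hn)
        exact ⟨[], by simp, by simp [altWord, this, refl_mul_self], by simp⟩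
      | succ k =>
        have h1 : x = if Even k then j else i := by
          by_cases hk : Even k
          · simp only [hk, parity_simps, not_true, if_false, if_true] at hn ⊢
            exact hx.resolve_left hn
          · simp only [hk, parity_simps, not_false_eq_true, if_false, if_true] at hn ⊢
            exact hx.resolve_right hn
        refine ⟨altWord i j k ++ [i], ?_, ?_, by simp [altWord]⟩
        · intro y hy
          rcases List.mem_append.1 hy with hy | hy
          · exact mem_altWord i j k y hy
          · exact Or.inl (by simpa using hy)
        · rw [altWord, ← h1]
          simp [← mul_assoc, refl_mul_self]
    · exact Or.inr (h.cons hx)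

lemma shortens_altWord_mono {i j : I} {m n : ℕ} (hmn : m ≤ n)
    (h : K.Shortens i j (altWord i j m)) : K.Shortens i j (altWord i j n) := by
  induction n, hmn using Nat.le_induction with
  | base => exact h
  | succ n _ ih => exact ih.cons (by split_ifs <;> simp)

lemma refl_left_apply (i j : I) (x : V) (r s : ℝ) :
    K.refl i (x + r • K.α i + s • K.α j) =
      x + (-K.coroot i x - r - K.a i j * s) • K.α i + s • K.α j := by
  simp only [refl_apply, map_add, map_smul, K.cartanPairing, K.diag]
  push_cast
  module

lemma refl_right_apply (i j : I) (x : V) (r s : ℝ) :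
    K.refl j (x + r • K.α i + s • K.α j) =
      x + r • K.α i + (-K.coroot j x - s - K.a j i * r) • K.α j := by
  simp only [refl_apply, map_add, map_smul, K.cartanPairing, K.diag]
  push_cast
  module

/-- Braid relations of rank two, in the form needed to shorten alternating words. -/
lemma shortens_altWord {i j : I} {m : ℕ}
    (h : (K.a i j, K.a j i, m) ∈ ({(0, 0, 2), (-1, -1, 3), (-1, -2, 4), (-2, -1, 4),
      (-1, -3, 6), (-3, -1, 6)} : Set (ℤ × ℤ × ℕ))) :
    K.Shortens i j (altWord i j m) := by
  have key : ∀ v u : List I, altWord i j m = v → (∀ x ∈ u, x = i ∨ x = j) → u.length < m →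
      (∀ x : V, K.wordProd (u ++ [i]) (x + (0 : ℝ) • K.α i + (0 : ℝ) • K.α j) =
        K.wordProd v (x + (0 : ℝ) • K.α i + (0 : ℝ) • K.α j)) →
      K.Shortens i j (altWord i j m) := by
    rintro v u rfl hu hl he
    refine ⟨u, hu, ?_, by rwa [length_altWord]⟩
    have : K.wordProd (u ++ [i]) = K.wordProd (altWord i j m) :=
      LinearEquiv.ext fun x => by simpa using he x
    rw [← this, wordProd_append, mul_assoc]
    simp [refl_mul_self]
  simp only [Set.mem_insert_iff, Set.mem_singleton_iff, Prod.mk.injEq] at h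
  rcases h with ⟨h1, h2, rfl⟩ | ⟨h1, h2, rfl⟩ | ⟨h1, h2, rfl⟩ | ⟨h1, h2, rfl⟩ | ⟨h1, h2, rfl⟩ |
    ⟨h1, h2, rfl⟩
  on_goal 1 => refine key [i, j] [j] ?_ (by simp) (by simp) fun x => ?_
  on_goal 3 => refine key [j, i, j] [i, j] ?_ (by simp) (by simp) fun x => ?_
  on_goal 5 => refine key [i, j, i, j] [j, i, j] ?_ (by simp) (by simp) fun x => ?_
  on_goal 7 => refine key [i, j, i, j] [j, i, j] ?_ (by simp) (by simp) fun x => ?_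
  on_goal 9 => refine key [i, j, i, j, i, j] [j, i, j, i, j] ?_ (by simp) (by simp) fun x => ?_
  on_goal 11 => refine key [i, j, i, j, i, j] [j, i, j, i, j] ?_ (by simp) (by simp) fun x => ?_
  any_goals simp [altWord, Nat.even_iff]; done
  all_goals
    simp only [List.cons_append, List.nil_append, wordProd_cons, wordProd_nil,
      LinearEquiv.mul_apply, LinearEquiv.coe_one, id_eq, refl_left_apply, refl_right_apply, h1, h2]
    push_cast
    module

/-- An alternating word which cannot be shortened maps `α i` to a nonnegative combination of
`α i` and `α j`. -/
lemma altCoeff_nonneg_or_shortens {i j : I} (hij : i ≠ j) (n : ℕ) :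
    (0 ≤ (altCoeff (-K.a i j) (-K.a j i) n).1 ∧ 0 ≤ (altCoeff (-K.a i j) (-K.a j i) n).2) ∨
      K.Shortens i j (altWord i j n) := by
  have ha := K.offDiag i j hij
  have hb := K.offDiag j i hij.symm
  have h0 := K.zeroIff i j
  by_cases hab : 4 ≤ K.a i j * K.a j i
  · left
    have ha' : K.a i j ≠ 0 := fun h => by simp [h] at hab
    have hb' : K.a j i ≠ 0 := fun h => by simp [h] at hab
    obtain ⟨h1, h2, -⟩ := altCoeff_nonneg (a := -K.a i j) (b := -K.a j i) (by omega) (by omega)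
      (by linarith) n
    exact ⟨h1, h2⟩
  obtain ⟨m, hm, hmem⟩ : ∃ m ≤ 6, (K.a i j, K.a j i, m) ∈ ({(0, 0, 2), (-1, -1, 3), (-1, -2, 4),
      (-2, -1, 4), (-1, -3, 6), (-3, -1, 6)} : Set (ℤ × ℤ × ℕ)) := by
    have ha3 : -3 ≤ K.a i j := by
      by_contra hlt
      have : K.a j i ≠ 0 := fun h => by have := h0.2 h; omega
      nlinarith [(by omega : K.a j i ≤ -1)]
    have hb3 : -3 ≤ K.a j i := by
      by_contra hlt
      have : K.a i j ≠ 0 := fun h => by have := h0.1 h; omega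
      nlinarith [(by omega : K.a i j ≤ -1)]
    generalize K.a i j = a at *
    generalize K.a j i = b at *
    interval_cases a <;> interval_cases b <;> simp_all
  by_cases hn : m ≤ n
  · exact Or.inr (K.shortens_altWord_mono hn (K.shortens_altWord hmem))
  left
  simp only [Set.mem_insert_iff, Set.mem_singleton_iff, Prod.mk.injEq] at hmem
  rcases hmem with ⟨h1, h2, rfl⟩ | ⟨h1, h2, rfl⟩ | ⟨h1, h2, rfl⟩ | ⟨h1, h2, rfl⟩ | ⟨h1, h2, rfl⟩ |
    ⟨h1, h2, rfl⟩ <;> rw [h1, h2] <;> interval_cases n <;> simp [altCoeff, Nat.even_iff]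

lemma root_combination_nonneg_of_not_shortens {i j : I} (hij : i ≠ j) {u : List I}
    (hu : ∀ x ∈ u, x = i ∨ x = j) (hs : ¬ K.Shortens i j u) :
    ∃ p q : ℕ, K.wordProd u (K.α i) = (p : ℝ) • K.α i + (q : ℝ) • K.α j := by
  obtain ⟨n, rfl⟩ := (K.eq_altWord_or_shortens u hu).resolve_right hs
  obtain ⟨hp, hq⟩ := (K.altCoeff_nonneg_or_shortens hij n).resolve_right hs
  obtain ⟨p, hp⟩ := Int.eq_ofNat_of_zero_le hp
  obtain ⟨q, hq⟩ := Int.eq_ofNat_of_zero_le hq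
  exact ⟨p, q, by rw [wordProd_altWord_root, hp, hq]; simp⟩

variable {K} in
lemma Qplus_add {x y : V} (hx : x ∈ K.Qplus) (hy : y ∈ K.Qplus) : x + y ∈ K.Qplus := by
  obtain ⟨c, rfl⟩ := hx
  obtain ⟨d, rfl⟩ := hy
  exact ⟨c + d, by simp [add_smul, Finset.sum_add_distrib]⟩

variable {K} in
lemma Qplus_smul {x : V} (hx : x ∈ K.Qplus) (n : ℕ) : (n : ℝ) • x ∈ K.Qplus := by
  obtain ⟨c, rfl⟩ := hx
  exact ⟨fun i => n * c i, by simp [Finset.smul_sum, smul_smul]⟩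

lemma root_mem_Qplus (i : I) : K.α i ∈ K.Qplus :=
  ⟨Pi.single i 1, by simp [Pi.single_apply, Finset.sum_ite_eq']⟩

lemma wordProd_root_mem_Qplus (n : ℕ) : ∀ (l : List I) (i : I), l.length = n →
    (∀ l', K.wordProd l' = K.wordProd l * K.refl i → n ≤ l'.length) →
    K.wordProd l (K.α i) ∈ K.Qplus := by
  induction n using Nat.strong_induction_on with
  | _ n ih =>
  intro l i hl hmin
  rcases List.eq_nil_or_concat l with rfl | ⟨l₀, j, rfl⟩
  · exact K.root_mem_Qplus i
  rw [List.concat_eq_append] at *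
  have hij : i ≠ j := by
    rintro rfl
    have := hmin l₀ (by simp [mul_assoc, refl_mul_self])
    simp at hl
    omega
  let D : ℕ → Prop := fun k => ∃ v u : List I, v.length = k ∧ (∀ x ∈ u, x = i ∨ x = j) ∧
    K.wordProd v * K.wordProd u = K.wordProd (l₀ ++ [j]) ∧ v.length + u.length ≤ n
  have hD : D l₀.length := ⟨l₀, [j], rfl, by simp, by simp, by simpa using hl.le⟩
  obtain ⟨v, u, hv, hu, hvu, hlen⟩ := Nat.find_spec ⟨_, hD⟩
  have hvlt : v.length < n := by
    have := Nat.find_min' ⟨_, hD⟩ hD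
    simp at hl
    omega
  have hpos : ∀ x, x = i ∨ x = j → K.wordProd v (K.α x) ∈ K.Qplus := by
    intro x hx
    refine ih _ hvlt v x rfl fun v' hv' => ?_
    by_contra hlt
    have : D v'.length := by
      refine ⟨v', x :: u, rfl, by simpa [hx] using hu, ?_, by simp; omega⟩
      rw [hv', wordProd_cons, mul_assoc, ← mul_assoc (K.refl x), refl_mul_self, one_mul, hvu]
    have := Nat.find_min' ⟨_, hD⟩ this
    omega
  obtain ⟨p, q, hpq⟩ := K.root_combination_nonneg_of_not_shortens hij hu (by
    rintro ⟨u', -, hu', hlt⟩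
    have := hmin (v ++ u') (by rw [wordProd_append, hu', ← mul_assoc, hvu])
    simp at this
    omega)
  rw [← hvu, LinearEquiv.mul_apply, hpq, map_add, map_smul, map_smul]
  exact Qplus_add (Qplus_smul (hpos i (Or.inl rfl)) p) (Qplus_smul (hpos j (Or.inr rfl)) q)

/-- Every real root is either positive or negative. -/
theorem root_mem_Qplus_or_neg {w : V ≃ₗ[ℝ] V} (hw : w ∈ K.weylGroup) (i : I) :
    w (K.α i) ∈ K.Qplus ∨ -w (K.α i) ∈ K.Qplus := by
  have hex : ∀ {w : V ≃ₗ[ℝ] V}, w ∈ K.weylGroup →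
      ∃ l, K.wordProd l = w ∧ ∀ l', K.wordProd l' = w → l.length ≤ l'.length := by
    intro w hw
    have h : ∃ n, ∃ l, K.wordProd l = w ∧ l.length = n :=
      let ⟨l, hl⟩ := K.exists_word hw; ⟨_, l, hl, rfl⟩
    obtain ⟨l, hl, hn⟩ := Nat.find_spec h
    exact ⟨l, hl, fun l' hl' => hn ▸ Nat.find_min' h ⟨l', hl', rfl⟩⟩
  obtain ⟨l, rfl, hmin⟩ := hex hw
  obtain ⟨l', hl', hmin'⟩ := hex (mul_mem hw (K.refl_mem i))
  rcases le_total l.length l'.length with hle | hle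
  · exact Or.inl (K.wordProd_root_mem_Qplus _ l i rfl fun l'' h => hle.trans (hmin' l'' h))
  · right
    have h : K.wordProd l' (K.α i) ∈ K.Qplus := by
      refine K.wordProd_root_mem_Qplus _ l' i rfl fun l'' h => hle.trans (hmin l'' ?_)
      rw [h, hl', mul_assoc, refl_mul_self, mul_one]
    rwa [hl', LinearEquiv.mul_apply, refl_root, map_neg] at h

lemma coeff_unique {c d : I → ℝ} (h : ∑ k, c k • K.α k = ∑ k, d k • K.α k) (k : I) :
    c k = d k := by
  have := Fintype.linearIndependent_iff.1 K.rootsIndep (fun k => c k - d k)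
    (by simp [sub_smul, Finset.sum_sub_distrib, h]) k
  linarith

/-- A positive real root proportional to a simple root is that simple root. -/
lemma root_eq_of_eq_nat_smul {w : V ≃ₗ[ℝ] V} (hw : w ∈ K.weylGroup) {i j : I} {n : ℕ}
    (h : w (K.α j) = (n : ℝ) • K.α i) : w (K.α j) = K.α i := by
  have h1 : K.α j = (n : ℝ) • w⁻¹ (K.α i) := by
    rw [← map_smul, ← h]; exact (w.symm_apply_apply _).symm
  obtain ⟨d, hd⟩ : ∃ d : I → ℤ, w⁻¹ (K.α i) = ∑ k, (d k : ℝ) • K.α k := by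
    rcases K.root_mem_Qplus_or_neg (inv_mem hw) i with ⟨c, hc⟩ | ⟨c, hc⟩
    · exact ⟨fun k => c k, by simpa using hc⟩
    · exact ⟨fun k => -c k, by rw [neg_eq_iff_eq_neg.1 hc]; simp⟩
  have h2 : ∑ k, ((Pi.single j 1 : I → ℝ) k) • K.α k = ∑ k, ((n : ℝ) * d k) • K.α k := by
    simp only [mul_smul, ← Finset.smul_sum]
    rw [← hd, ← h1]
    simp [Pi.single_apply]
  have h3 : (n : ℤ) * d j = 1 := by
    have := K.coeff_unique h2 j
    rw [Pi.single_eq_same] at this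
    exact_mod_cast this.symm
  have h4 : n = 1 := by
    have := Int.eq_one_or_neg_one_of_mul_eq_one h3
    omega
  rw [h, h4]; simp

/-- A simple reflection maps positive real roots, except its own simple root, to positive roots. -/
lemma refl_mem_Qplus {w : V ≃ₗ[ℝ] V} (hw : w ∈ K.weylGroup) {i j : I}
    (hpos : w (K.α j) ∈ K.Qplus) (hne : w (K.α j) ≠ K.α i) :
    K.refl i (w (K.α j)) ∈ K.Qplus := by
  refine (K.root_mem_Qplus_or_neg (mul_mem (K.refl_mem i) hw) j).resolve_right ?_
  rintro ⟨d, hd⟩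
  obtain ⟨c, hc⟩ := hpos
  refine hne (K.root_eq_of_eq_nat_smul (n := c i) hw ?_)
  have h1 : ∑ k, ((Pi.single i (K.coroot i (w (K.α j))) : I → ℝ) k) • K.α k =
      ∑ k, ((c k : ℝ) + d k) • K.α k := by
    simp only [add_smul, Finset.sum_add_distrib, ← hc, ← hd]
    simp [Pi.single_apply, refl_apply]
  rw [hc]
  refine Finset.sum_eq_single i (fun k _ hk => ?_) (by simp)
  have := K.coeff_unique h1 k
  rw [Pi.single_eq_of_ne hk] at this
  have : c k = 0 := by
    have : c k + d k = 0 := by exact_mod_cast this.symm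
    omega
  simp [this]

/-- The coroot `w α_j∨` corresponds to the root `w α_j` under the symmetrizing form. -/
lemma exists_root_coroot_coeff {w : V ≃ₗ[ℝ] V} (hw : w ∈ K.weylGroup) (j : I) :
    ∃ c : I → ℤ, w (K.α j) = ∑ k, (c k : ℝ) • K.α k ∧
      ∀ x, (K.d j : ℝ) * K.coroot j (w⁻¹ x) = ∑ k, (c k : ℝ) * K.d k * K.coroot k x := by
  obtain ⟨l, rfl⟩ := K.exists_word hw
  clear hw
  induction l with
  | nil =>
    refine ⟨Pi.single j 1, ?_, fun x => ?_⟩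
    · simp [Pi.single_apply, Finset.sum_ite_eq']
    · simp [Pi.single_apply, Finset.sum_ite_eq']
  | cons i l ih =>
    obtain ⟨c, hc, hx⟩ := ih
    refine ⟨c - Pi.single i (∑ k, c k * K.a i k), ?_, fun x => ?_⟩
    · rw [wordProd_cons, LinearEquiv.mul_apply, hc, refl_apply]
      simp [sub_smul, Finset.sum_sub_distrib, Pi.single_apply, K.cartanPairing, ite_smul]
    · have hs : ∀ k, (K.d k : ℝ) * K.a k i = K.d i * K.a i k := fun k => by
        exact_mod_cast K.symmetrizable k i
      rw [wordProd_cons, mul_inv_rev, LinearEquiv.mul_apply, refl_inv, hx, refl_apply]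
      have h1 : ∀ k, (c k : ℝ) * K.d k * K.coroot k (x - K.coroot i x • K.α i) =
          (c k : ℝ) * K.d k * K.coroot k x - (c k * K.a i k) * (K.d i * K.coroot i x) := by
        intro k
        rw [map_sub, map_smul, K.cartanPairing, smul_eq_mul]
        linear_combination (-(c k : ℝ) * K.coroot i x) * hs k
      simp only [h1, Finset.sum_sub_distrib, ← Finset.sum_mul]
      simp [sub_mul, Finset.sum_sub_distrib, Pi.single_apply]
      ring

lemma coroot_symm_of_root_eq {w : V ≃ₗ[ℝ] V} (hw : w ∈ K.weylGroup) {i j : I}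
    (h : w (K.α j) = K.α i) (x : V) : K.coroot j (w.symm x) = K.coroot i x := by
  obtain ⟨c, hc, hx⟩ := K.exists_root_coroot_coeff hw j
  have h1 : ∑ k, ((Pi.single i 1 : I → ℝ) k) • K.α k = ∑ k, (c k : ℝ) • K.α k := by
    rw [← hc, h]; simp [Pi.single_apply]
  have h2 : ∀ x, (K.d j : ℝ) * K.coroot j (w.symm x) = K.d i * K.coroot i x := by
    intro x
    refine (hx x).trans ?_
    simp only [← K.coeff_unique h1]
    simp [Pi.single_apply]
  have h3 : w.symm (K.α i) = K.α j := by rw [← h, w.symm_apply_apply]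
  have h4 := h2 (K.α i)
  rw [h3, coroot_self, coroot_self] at h4
  have h5 : (K.d i : ℝ) ≠ 0 := by exact_mod_cast (K.dPos i).ne'
  have h6 := h2 x
  rw [mul_right_cancel₀ two_ne_zero h4] at h6
  exact mul_left_cancel₀ h5 h6

end KacMoodyData

/-- A continuous function, constant outside `[0,1]` and vanishing at `0`, all of whose (weak) local
minima are integers. -/
structure HasIntegralMinima (h : ℝ → ℝ) : Prop where
  continuous : Continuous h
  eq_zero : ∀ t ≤ 0, h t = 0
  eq_one : ∀ t, 1 ≤ t → h t = h 1
  integral : ∀ t, IsLocalMin h t → ∃ n : ℤ, h t = n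

/-- The minimum of a function on `[0,1]`. -/
def minVal (h : ℝ → ℝ) : ℝ := sInf (h '' Set.Icc 0 1)

/-- The running minimum of a function. -/
def runMin (h : ℝ → ℝ) (t : ℝ) : ℝ := sInf (h '' Set.Iic t)

/-- The coefficient of `α i` by which a raising operator modifies a path, in terms of the pairing
`h` of the path with the simple coroot. -/
def raiseCoeff (h : ℝ → ℝ) (t : ℝ) : ℝ := max 0 (minVal h + 1 - runMin h t)

/-- The interval `[t₀, t₁]` on which a raising operator reflects a path. -/
structure IsRaiseInterval (h : ℝ → ℝ) (t₀ t₁ : ℝ) : Prop where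
  nonneg : 0 ≤ t₀
  lt : t₀ < t₁
  le_one : t₁ ≤ 1
  left_eq : h t₀ = minVal h + 1
  right_eq : h t₁ = minVal h
  le_of_le : ∀ t ≤ t₀, minVal h + 1 ≤ h t
  lt_of_lt : ∀ t < t₁, minVal h < h t
  strictAntiOn : StrictAntiOn h (Set.Icc t₀ t₁)

lemma isLocalMin_of_forall_Icc {h : ℝ → ℝ} {a b z : ℝ} (hz : z ∈ Set.Ioo a b)
    (hmin : ∀ t ∈ Set.Icc a b, h z ≤ h t) : IsLocalMin h z :=
  Filter.mem_of_superset (Icc_mem_nhds hz.1 hz.2) hmin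

namespace HasIntegralMinima

variable {h : ℝ → ℝ} (hh : HasIntegralMinima h)

include hh

lemma exists_minVal : ∃ t ∈ Set.Icc (0 : ℝ) 1, h t = minVal h := by
  obtain ⟨t, ht, he⟩ := isCompact_Icc.exists_sInf_image_eq
    (Set.nonempty_Icc.2 zero_le_one) hh.continuous.continuousOn
  exact ⟨t, ht, he.symm⟩

lemma minVal_le (t : ℝ) : minVal h ≤ h t := by
  have key : ∀ t ∈ Set.Icc (0 : ℝ) 1, minVal h ≤ h t := fun t ht =>
    csInf_le (isCompact_Icc.image hh.continuous).bddBelow ⟨t, ht, rfl⟩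
  rcases le_total t 0 with h0 | h0
  · rw [hh.eq_zero t h0, ← hh.eq_zero 0 le_rfl]
    exact key 0 (by simp)
  rcases le_total 1 t with h1 | h1
  · rw [hh.eq_one t h1]
    exact key 1 (by simp)
  · exact key t ⟨h0, h1⟩

lemma minVal_eq {c t : ℝ} (hc : h t = c) (hle : ∀ s, c ≤ h s) :
    minVal h = c := by
  obtain ⟨s, -, hs⟩ := hh.exists_minVal
  exact le_antisymm (hc ▸ hh.minVal_le t) (hs ▸ hle s)

lemma exists_minVal_eq_neg : ∃ k : ℕ, minVal h = -(k : ℝ) := by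
  obtain ⟨t, -, ht⟩ := hh.exists_minVal
  obtain ⟨n, hn⟩ := hh.integral t (Filter.Eventually.of_forall fun s => ht ▸ hh.minVal_le s)
  have h0 := hh.minVal_le 0
  rw [hh.eq_zero 0 le_rfl, ← ht, hn] at h0
  have hn0 : n ≤ 0 := by exact_mod_cast h0
  refine ⟨n.natAbs, ?_⟩
  rw [← ht, hn, Nat.cast_natAbs, abs_of_nonpos hn0]
  simp

lemma minVal_add_one_nonpos (hN : minVal h ≠ 0) : minVal h + 1 ≤ 0 := by
  obtain ⟨k, hk⟩ := hh.exists_minVal_eq_neg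
  have : 1 ≤ k := Nat.one_le_iff_ne_zero.2 fun h0 => hN (by simp [hk, h0])
  have : (1 : ℝ) ≤ k := by exact_mod_cast this
  linarith

lemma not_isLocalMin_of_mem_Ioo {t : ℝ} (ht : h t ∈ Set.Ioo (minVal h) (minVal h + 1)) :
    ¬ IsLocalMin h t := by
  intro hmin
  obtain ⟨n, hn⟩ := hh.integral t hmin
  obtain ⟨k, hk⟩ := hh.exists_minVal_eq_neg
  obtain ⟨h1, h2⟩ := ht
  rw [hk, hn] at h1 h2
  have h1' : -(k : ℤ) < n := by exact_mod_cast h1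
  have h2' : n < -(k : ℤ) + 1 := by exact_mod_cast h2
  omega

lemma exists_isRaiseInterval (hN : minVal h ≠ 0) : ∃ t₀ t₁,
    IsLeast {t | t ∈ Set.Icc (0 : ℝ) 1 ∧ h t = minVal h} t₁ ∧
    IsGreatest {t | t ∈ Set.Icc (0 : ℝ) t₁ ∧ h t = minVal h + 1} t₀ ∧
    IsRaiseInterval h t₀ t₁ := by
  have hN1 := hh.minVal_add_one_nonpos hN
  have h00 := hh.eq_zero 0 le_rfl
  have hclosed : ∀ a b c : ℝ, IsCompact {t | t ∈ Set.Icc a b ∧ h t = c} := fun a b c =>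
    isCompact_Icc.inter_right (isClosed_eq hh.continuous continuous_const)
  obtain ⟨t₁, ht₁⟩ := (hclosed 0 1 (minVal h)).exists_isLeast hh.exists_minVal
  have ht₁0 : 0 ≤ t₁ := ht₁.1.1.1
  have ivt : ∀ s ≤ t₁, minVal h + 1 ≤ h s → ∃ t ∈ Set.Icc s t₁, h t = minVal h + 1 := by
    intro s hs hle
    exact intermediate_value_Icc' hs hh.continuous.continuousOn
      ⟨by rw [ht₁.1.2]; linarith, hle⟩
  obtain ⟨t₀, ht₀⟩ := (hclosed 0 t₁ (minVal h + 1)).exists_isGreatest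
    (ivt 0 ht₁0 (by rw [h00]; exact hN1))
  have hlt : t₀ < t₁ := lt_of_le_of_ne ht₀.1.1.2 fun he => by
    have h1 := ht₀.1.2
    rw [he, ht₁.1.2] at h1
    linarith
  have hright : ∀ t < t₁, minVal h < h t := by
    intro t ht
    refine lt_of_le_of_ne (hh.minVal_le t) fun he => ?_
    rcases lt_or_ge t 0 with h0 | h0
    · rw [hh.eq_zero t h0.le] at he
      exact hN he
    · exact absurd (ht₁.2 ⟨⟨h0, ht.le.trans ht₁.1.1.2⟩, he.symm⟩) (not_le.2 ht)
  have hmid : ∀ t, t₀ < t → t < t₁ → h t < minVal h + 1 := by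
    intro t h0 h1
    by_contra! hle
    obtain ⟨s, hs, he⟩ := ivt t h1.le hle
    exact absurd (ht₀.2 ⟨⟨ht₀.1.1.1.trans (h0.le.trans hs.1), hs.2⟩, he⟩)
      (not_le.2 (h0.trans_le hs.1))
  refine ⟨t₀, t₁, ht₁, ht₀, ht₀.1.1.1, hlt, ht₁.1.1.2, ht₀.1.2, ht₁.1.2, ?_, hright, ?_⟩
  · intro t ht
    by_contra! hlt'
    rcases lt_or_ge t 0 with h0 | h0
    · rw [hh.eq_zero t h0.le] at hlt'
      linarith
    obtain ⟨z, hz, hmin⟩ := isCompact_Icc.exists_isMinOn ⟨t, h0, ht⟩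
      hh.continuous.continuousOn
    have hzt : h z ≤ h t := hmin ⟨h0, ht⟩
    have hz0 : z ≠ 0 := by
      rintro rfl
      linarith
    have hz1 : z ≠ t₀ := by
      rintro rfl
      linarith [ht₀.1.2]
    exact hh.not_isLocalMin_of_mem_Ioo ⟨hright z (hz.2.trans_lt hlt), hzt.trans_lt hlt'⟩
      (isLocalMin_of_forall_Icc ⟨lt_of_le_of_ne hz.1 hz0.symm, lt_of_le_of_ne hz.2 hz1⟩ hmin)
  · intro x hx y hy hxy
    by_contra! hle
    rcases hy.2.eq_or_lt with rfl | hy1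
    · exact absurd (hright x hxy) (not_lt.2 (ht₁.1.2 ▸ hle))
    rcases hx.1.eq_or_lt with rfl | hx0
    · exact absurd (hmid y hxy hy1) (not_lt.2 (ht₀.1.2 ▸ hle))
    obtain ⟨z, hz, hmin⟩ := isCompact_Icc.exists_isMinOn ⟨x, hx.1, hxy.le⟩
      hh.continuous.continuousOn
    have hzx : h z ≤ h x := hmin ⟨hx.1, hxy.le⟩
    have hx2 := hmid x hx0 (hxy.trans hy1)
    obtain ⟨z', hz', hmin', hz'x⟩ : ∃ z' ∈ Set.Ioo t₀ y, (∀ t ∈ Set.Icc t₀ y, h z' ≤ h t) ∧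
        h z' ≤ h x := by
      rcases hz.2.eq_or_lt with rfl | hzy
      · exact ⟨x, ⟨hx0, hxy⟩, fun t ht => hle.trans (hmin ht), le_rfl⟩
      · refine ⟨z, ⟨lt_of_le_of_ne hz.1 ?_, hzy⟩, hmin, hzx⟩
        rintro rfl
        linarith [ht₀.1.2]
    exact hh.not_isLocalMin_of_mem_Ioo
      ⟨hright z' (hz'.2.trans hy1), hz'x.trans_lt hx2⟩ (isLocalMin_of_forall_Icc hz' hmin')

lemma bddBelow_image (s : Set ℝ) : BddBelow (h '' s) :=
  ⟨minVal h, by rintro _ ⟨t, -, rfl⟩; exact hh.minVal_le t⟩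

omit hh in
lemma runMin_eq {c s t : ℝ} (hst : s ≤ t) (hs : h s = c) (hle : ∀ r ≤ t, c ≤ h r) :
    runMin h t = c :=
  IsLeast.csInf_eq ⟨⟨s, hst, hs⟩, by rintro _ ⟨r, hr, rfl⟩; exact hle r hr⟩

lemma runMin_le {s t : ℝ} (hst : s ≤ t) : runMin h t ≤ h s :=
  csInf_le (hh.bddBelow_image _) ⟨s, hst, rfl⟩

omit hh in
lemma le_runMin {c t : ℝ} (hle : ∀ r ≤ t, c ≤ h r) : c ≤ runMin h t :=
  le_csInf ⟨_, t, Set.mem_Iic.2 le_rfl, rfl⟩ (by rintro _ ⟨r, hr, rfl⟩; exact hle r hr)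

end HasIntegralMinima

namespace IsRaiseInterval

variable {h : ℝ → ℝ} (hh : HasIntegralMinima h) {t₀ t₁ : ℝ} (hI : IsRaiseInterval h t₀ t₁)

include hI

lemma raiseCoeff_of_le {t : ℝ} (ht : t ≤ t₀) : raiseCoeff h t = 0 := by
  have := HasIntegralMinima.le_runMin fun r hr => hI.le_of_le r (hr.trans ht)
  exact max_eq_left (by linarith)

lemma le_add_one {t : ℝ} (ht : t₀ ≤ t) (ht' : t ≤ t₁) : h t ≤ minVal h + 1 := by
  rw [← hI.left_eq]
  exact hI.strictAntiOn.antitoneOn ⟨le_rfl, hI.lt.le⟩ ⟨ht, ht'⟩ ht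

lemma raiseCoeff_of_mem {t : ℝ} (ht : t₀ ≤ t) (ht' : t ≤ t₁) :
    raiseCoeff h t = minVal h + 1 - h t := by
  have hle := hI.le_add_one ht ht'
  rw [raiseCoeff, HasIntegralMinima.runMin_eq le_rfl rfl fun r hr => ?_]
  · exact max_eq_right (by linarith)
  rcases le_total r t₀ with h0 | h0
  · exact hle.trans (hI.le_of_le r h0)
  · exact hI.strictAntiOn.antitoneOn ⟨h0, hr.trans ht'⟩ ⟨ht, ht'⟩ hr

include hh

lemma raiseCoeff_of_ge {t : ℝ} (ht : t₁ ≤ t) : raiseCoeff h t = 1 := by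
  rw [raiseCoeff, HasIntegralMinima.runMin_eq ht hI.right_eq fun r _ => hh.minVal_le r]
  simp

lemma raiseCoeff_eq (t : ℝ) :
    raiseCoeff h t = minVal h + 1 - h (max t₀ (min t₁ t)) := by
  rcases le_total t t₀ with h0 | h0
  · rw [hI.raiseCoeff_of_le h0, min_eq_right (h0.trans hI.lt.le), max_eq_left h0, hI.left_eq]
    ring
  rcases le_total t t₁ with h1 | h1
  · rw [hI.raiseCoeff_of_mem h0 h1, min_eq_right h1, max_eq_right h0]
  · rw [hI.raiseCoeff_of_ge hh h1, min_eq_left h1, max_eq_right hI.lt.le, hI.right_eq]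
    ring

lemma le_raise (t : ℝ) : minVal h + 1 ≤ h t + 2 * raiseCoeff h t := by
  rcases le_total t t₀ with h0 | h0
  · rw [hI.raiseCoeff_of_le h0]
    linarith [hI.le_of_le t h0]
  rcases le_total t t₁ with h1 | h1
  · rw [hI.raiseCoeff_of_mem h0 h1]
    linarith [hI.le_add_one h0 h1]
  · rw [hI.raiseCoeff_of_ge hh h1]
    linarith [hh.minVal_le t]

omit hh in
lemma raise_left : h t₀ + 2 * raiseCoeff h t₀ = minVal h + 1 := by
  rw [hI.raiseCoeff_of_le le_rfl, hI.left_eq]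
  ring

lemma hasIntegralMinima : HasIntegralMinima fun t => h t + 2 * raiseCoeff h t where
  continuous := by
    have := hh.continuous
    simp only [hI.raiseCoeff_eq hh]
    fun_prop
  eq_zero t ht := by
    rw [hI.raiseCoeff_of_le (ht.trans hI.nonneg), hh.eq_zero t ht]
    ring
  eq_one t ht := by
    rw [hI.raiseCoeff_of_ge hh (hI.le_one.trans ht), hI.raiseCoeff_of_ge hh hI.le_one,
      hh.eq_one t ht]
  integral t ht := by
    obtain ⟨k, hk⟩ := hh.exists_minVal_eq_neg
    rcases lt_trichotomy t t₀ with h0 | rfl | h0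
    · have he : (fun t => h t + 2 * raiseCoeff h t) =ᶠ[nhds t] h := by
        filter_upwards [Iio_mem_nhds h0] with s hs
        rw [hI.raiseCoeff_of_le (le_of_lt hs)]
        ring
      obtain ⟨n, hn⟩ := hh.integral t (ht.congr he)
      exact ⟨n, he.eq_of_nhds.trans hn⟩
    · exact ⟨-k + 1, by rw [hI.raise_left, hk]; push_cast; ring⟩
    rcases lt_trichotomy t t₁ with h1 | rfl | h1
    · exfalso
      have hev : ∀ᶠ s in nhdsWithin t (Set.Iio t),
          h t + 2 * raiseCoeff h t ≤ h s + 2 * raiseCoeff h s := ht.filter_mono nhdsWithin_le_nhds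
      obtain ⟨s, hs, hst⟩ := (hev.and (Ioo_mem_nhdsLT h0)).exists
      rw [hI.raiseCoeff_of_mem h0.le h1.le,
        hI.raiseCoeff_of_mem hst.1.le (hst.2.trans h1).le] at hs
      linarith [hI.strictAntiOn ⟨hst.1.le, (hst.2.trans h1).le⟩ ⟨h0.le, h1.le⟩ hst.2]
    · refine ⟨-k + 2, ?_⟩
      rw [hI.raiseCoeff_of_ge hh le_rfl, hI.right_eq, hk]
      push_cast
      ring
    · have he : (fun t => h t + 2 * raiseCoeff h t) =ᶠ[nhds t] fun t => h t + 2 := by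
        filter_upwards [Ioi_mem_nhds h1] with s hs
        rw [hI.raiseCoeff_of_ge hh (le_of_lt hs)]
        ring
      have hmin : IsLocalMin h t := by
        filter_upwards [ht.congr he] with s hs
        linarith
      obtain ⟨n, hn⟩ := hh.integral t hmin
      exact ⟨n + 2, by rw [he.eq_of_nhds, hn]; push_cast; ring⟩

lemma minVal_raise : minVal (fun t => h t + 2 * raiseCoeff h t) = minVal h + 1 :=
  (hI.hasIntegralMinima hh).minVal_eq hI.raise_left (hI.le_raise hh)

lemma runMin_raise (t : ℝ) :
    runMin (fun t => h t + 2 * raiseCoeff h t) t = max (runMin h t) (minVal h + 1) := by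
  rcases le_total t t₀ with h0 | h0
  · rw [max_eq_left (HasIntegralMinima.le_runMin fun r hr => hI.le_of_le r (hr.trans h0))]
    refine congrArg sInf (Set.image_congr fun r hr => ?_)
    rw [hI.raiseCoeff_of_le (le_trans hr h0)]
    ring
  · rw [max_eq_right (hI.left_eq ▸ hh.runMin_le h0)]
    exact HasIntegralMinima.runMin_eq h0 (hI.raise_left) fun r _ => hI.le_raise hh r

end IsRaiseInterval

namespace HasIntegralMinima

lemma reverse {h : ℝ → ℝ} (hh : HasIntegralMinima h) :
    HasIntegralMinima fun t => h (1 - t) - h 1 where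
  continuous := by
    have := hh.continuous
    fun_prop
  eq_zero t ht := by rw [hh.eq_one (1 - t) (by linarith), sub_self]
  eq_one t ht := by rw [hh.eq_zero (1 - t) (by linarith), sub_self, hh.eq_zero 0 le_rfl]
  integral t ht := by
    have h1 : IsLocalMin h 2 := by
      filter_upwards [Ioi_mem_nhds (show (1 : ℝ) < 2 by norm_num)] with s hs
      rw [hh.eq_one 2 (by norm_num), hh.eq_one s (le_of_lt hs)]
    obtain ⟨k, hk⟩ := hh.integral 2 h1
    rw [hh.eq_one 2 (by norm_num)] at hk
    have h2 : IsLocalMin h (1 - t) := by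
      have hc : Filter.Tendsto (fun s : ℝ => 1 - s) (nhds (1 - t)) (nhds t) :=
        (continuous_const.sub continuous_id).tendsto' _ _ (by simp)
      filter_upwards [hc.eventually ht] with s hs
      simpa using hs
    obtain ⟨n, hn⟩ := hh.integral _ h2
    exact ⟨n - k, by rw [hn, hk]; push_cast; ring⟩

lemma minVal_reverse {h : ℝ → ℝ} (hh : HasIntegralMinima h) :
    minVal (fun t => h (1 - t) - h 1) = minVal h - h 1 := by
  obtain ⟨t, ht, he⟩ := hh.exists_minVal
  refine hh.reverse.minVal_eq (t := 1 - t) ?_ fun s => ?_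
  · simp [he]
  · linarith [hh.minVal_le (1 - s)]

lemma const_mul {h : ℝ → ℝ} (hh : HasIntegralMinima h) {m : ℕ} (hm : 1 ≤ m) :
    HasIntegralMinima fun t => (m : ℝ) * h t where
  continuous := hh.continuous.const_mul _
  eq_zero t ht := by rw [hh.eq_zero t ht, mul_zero]
  eq_one t ht := by rw [hh.eq_one t ht]
  integral t ht := by
    have hm0 : (0 : ℝ) < m := by exact_mod_cast hm
    obtain ⟨n, hn⟩ := hh.integral t (ht.mono fun s hs => le_of_mul_le_mul_left hs hm0)
    exact ⟨m * n, by rw [hn]; push_cast; rfl⟩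

end HasIntegralMinima

lemma sInf_image_const_mul (m : ℕ) (h : ℝ → ℝ) (s : Set ℝ) :
    sInf ((fun t => (m : ℝ) * h t) '' s) = m * sInf (h '' s) := by
  rw [← smul_eq_mul, ← Real.sInf_smul_of_nonneg (Nat.cast_nonneg m)]
  congr 1
  ext x
  simp [Set.mem_smul_set]

/-- The reversed path, from `0` to `-g 1`. -/
def rev {V : Type*} [AddCommGroup V] (g : ℝ → V) : ℝ → V := fun t => g (1 - t) - g 1

lemma rev_rev {V : Type*} [AddCommGroup V] {g : ℝ → V} (h0 : g 0 = 0) : rev (rev g) = g := by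
  funext t
  simp [rev, h0]

namespace KacMoodyData

variable {I V : Type*} [Fintype I] [DecidableEq I] [AddCommGroup V] [Module ℝ V]
variable (K : KacMoodyData I V)

/-- A path starting at `0` whose pairing with the simple coroot `i` has only integral local
minima. -/
structure IsGoodPath (i : I) (g : ℝ → V) : Prop where
  hasIntegralMinima : HasIntegralMinima (K.H i g)
  zero : g 0 = 0

lemma H_dilate (i : I) (m : ℕ) (g : ℝ → V) :
    K.H i (dilate m g) = fun t => (m : ℝ) * K.H i g t := by
  funext t
  simp [H, dilate]

lemma H_rev (i : I) (g : ℝ → V) : K.H i (rev g) = fun t => K.H i g (1 - t) - K.H i g 1 := by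
  funext t
  simp [H, rev]

lemma H_add_raiseCoeff (i : I) (g : ℝ → V) :
    K.H i (fun t => g t + raiseCoeff (K.H i g) t • K.α i) =
      fun t => K.H i g t + 2 * raiseCoeff (K.H i g) t := by
  funext t
  simp only [H, map_add, map_smul, coroot_self, smul_eq_mul]
  ring

lemma rev_dilate (m : ℕ) (g : ℝ → V) : rev (dilate m g) = dilate m (rev g) := by
  funext t
  simp [rev, dilate, smul_sub]

variable {K} {i : I} {g : ℝ → V}

namespace IsGoodPath

variable (hg : K.IsGoodPath i g)

include hg

lemma dilate {m : ℕ} (hm : 1 ≤ m) : K.IsGoodPath i (dilate m g) where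
  hasIntegralMinima := K.H_dilate i m g ▸ hg.hasIntegralMinima.const_mul hm
  zero := by simp [LSPaper.dilate, hg.zero]

lemma rev : K.IsGoodPath i (rev g) where
  hasIntegralMinima := K.H_rev i g ▸ hg.hasIntegralMinima.reverse
  zero := by simp [LSPaper.rev]

lemma eraw_eq (hN : minVal (K.H i g) ≠ 0) :
    K.eraw i g = fun t => g t + raiseCoeff (K.H i g) t • K.α i := by
  obtain ⟨t₀, t₁, h₁, h₀, hI⟩ := hg.hasIntegralMinima.exists_isRaiseInterval hN
  have hm : K.mval i g = minVal (K.H i g) := rfl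
  funext t
  simp only [eraw, hm, h₁.csInf_eq, h₀.csSup_eq]
  split_ifs with ht ht'
  · simp [hI.raiseCoeff_of_le ht]
  · rw [hI.raiseCoeff_of_mem (not_le.1 ht).le ht', ← hI.left_eq, refl_apply,
      map_sub]
    simp only [H]
    module
  · rw [hI.raiseCoeff_of_ge hg.hasIntegralMinima (not_le.1 ht').le, one_smul]

lemma fraw_eq (hN : minVal (K.H i (LSPaper.rev g)) ≠ 0) :
    K.fraw i g = LSPaper.rev (K.eraw i (LSPaper.rev g)) := by
  obtain ⟨t₀, t₁, h₁, h₀, hI⟩ := hg.rev.hasIntegralMinima.exists_isRaiseInterval hN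
  have hr : ∀ t, K.H i (LSPaper.rev g) t = K.H i g (1 - t) - K.H i g 1 := congrFun (K.H_rev i g)
  have hmin : minVal (K.H i (LSPaper.rev g)) = minVal (K.H i g) - K.H i g 1 := by
    rw [H_rev, hg.hasIntegralMinima.minVal_reverse]
  have h₁' : IsGreatest {t | t ∈ Set.Icc (0 : ℝ) 1 ∧ K.H i g t = minVal (K.H i g)} (1 - t₁) := by
    obtain ⟨⟨⟨ha, hb⟩, hc⟩, hd⟩ := h₁
    rw [hr] at hc
    refine ⟨⟨⟨by linarith, by linarith⟩, by linarith⟩, fun t ht => ?_⟩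
    have := hd (a := 1 - t) ⟨⟨by linarith [ht.1.2], by linarith [ht.1.1]⟩, by
      rw [hr, hmin, sub_sub_cancel, ht.2]⟩
    linarith
  have h₀' : IsLeast {t | t ∈ Set.Icc (1 - t₁) 1 ∧ K.H i g t = minVal (K.H i g) + 1} (1 - t₀) := by
    obtain ⟨⟨⟨ha, hb⟩, hc⟩, hd⟩ := h₀
    rw [hr] at hc
    refine ⟨⟨⟨by linarith, by linarith⟩, by linarith⟩, fun t ht => ?_⟩
    have := hd (a := 1 - t) ⟨⟨by linarith [ht.1.2], by linarith [ht.1.1]⟩, by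
      rw [hr, hmin, sub_sub_cancel, ht.2]; ring⟩
    linarith
  have hm : K.mval i g = minVal (K.H i g) := rfl
  have hs : K.H i g (1 - t₁) = minVal (K.H i g) := h₁'.1.2
  have hrt : ∀ t, LSPaper.rev (K.eraw i (LSPaper.rev g)) t =
      g t + (raiseCoeff (K.H i (LSPaper.rev g)) (1 - t) - 1) • K.α i := by
    intro t
    rw [hg.rev.eraw_eq hN]
    simp only [LSPaper.rev]
    rw [sub_sub_cancel, sub_self, hg.zero,
      hI.raiseCoeff_of_ge hg.rev.hasIntegralMinima hI.le_one]
    module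
  funext t
  rw [hrt]
  simp only [fraw, hm, h₁'.csSup_eq, h₀'.csInf_eq]
  split_ifs with ht ht'
  · rw [hI.raiseCoeff_of_ge hg.rev.hasIntegralMinima (by linarith)]
    simp
  · rw [hI.raiseCoeff_of_mem (by linarith) (by linarith), hmin, hr,
      sub_sub_cancel, ← hs, refl_apply, map_sub]
    simp only [H]
    module
  · rw [hI.raiseCoeff_of_le (by linarith)]
    module

lemma add_raiseCoeff (hN : minVal (K.H i g) ≠ 0) :
    K.IsGoodPath i fun t => g t + raiseCoeff (K.H i g) t • K.α i := by
  obtain ⟨t₀, t₁, -, -, hI⟩ := hg.hasIntegralMinima.exists_isRaiseInterval hN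
  refine ⟨K.H_add_raiseCoeff i g ▸ hI.hasIntegralMinima hg.hasIntegralMinima, ?_⟩
  simp [hg.zero, hI.raiseCoeff_of_le hI.nonneg]

lemma eop_eq : K.eop i g = if minVal (K.H i g) = 0 then none else
    some fun t => g t + raiseCoeff (K.H i g) t • K.α i := by
  by_cases hN : minVal (K.H i g) = 0
  · rw [if_pos hN]
    exact if_pos hN
  · rw [if_neg hN, ← hg.eraw_eq hN]
    exact if_neg hN

lemma of_eop {g' : ℝ → V} (h : K.eop i g = some g') : K.IsGoodPath i g' := by
  rw [hg.eop_eq] at h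
  split_ifs at h with hN
  exact Option.some.inj h ▸ hg.add_raiseCoeff hN

lemma fop_eq : K.fop i g = (K.eop i (LSPaper.rev g)).map LSPaper.rev := by
  have hmin : minVal (K.H i (LSPaper.rev g)) = minVal (K.H i g) - K.H i g 1 := by
    rw [H_rev, hg.hasIntegralMinima.minVal_reverse]
  have h0 : K.H i g 1 - K.mval i g = 0 ↔ K.mval i (LSPaper.rev g) = 0 := by
    change K.H i g 1 - minVal (K.H i g) = 0 ↔ minVal (K.H i (LSPaper.rev g)) = 0
    rw [hmin, sub_eq_zero, sub_eq_zero, eq_comm]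
  by_cases hN : K.mval i (LSPaper.rev g) = 0
  · rw [fop, eop, if_pos hN, if_pos (h0.2 hN), Option.map_none]
  · rw [fop, eop, if_neg hN, if_neg (mt h0.1 hN), Option.map_some, hg.fraw_eq hN]

end IsGoodPath

variable (K) in
lemma eIter_succ (i : I) (n : ℕ) (g : ℝ → V) :
    K.eIter i (n + 1) g = (K.eop i g).bind (K.eIter i n) := by
  rw [eIter, Function.iterate_succ_apply, Option.bind_some]
  cases K.eop i g with
  | some g' => rfl
  | none => exact Function.iterate_fixed rfl n

variable (K) in
lemma fIter_succ (i : I) (n : ℕ) (g : ℝ → V) :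
    K.fIter i (n + 1) g = (K.fop i g).bind (K.fIter i n) := by
  rw [fIter, Function.iterate_succ_apply, Option.bind_some]
  cases K.fop i g with
  | some g' => rfl
  | none => exact Function.iterate_fixed rfl n

namespace IsGoodPath

lemma fIter_eq (n : ℕ) (hg : K.IsGoodPath i g) :
    K.fIter i n g = (K.eIter i n (LSPaper.rev g)).map LSPaper.rev := by
  induction n generalizing g with
  | zero => simp [fIter, eIter, rev_rev hg.zero]
  | succ n ih =>
    rw [fIter_succ, eIter_succ, hg.fop_eq]
    cases h : K.eop i (LSPaper.rev g) with
    | none => rfl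
    | some g' =>
      have hg' := hg.rev.of_eop h
      simp only [Option.map_some, Option.bind_some]
      rw [ih hg'.rev, rev_rev hg'.zero]

lemma phi_eq (hg : K.IsGoodPath i g) : K.phi i g = K.epsilon i (LSPaper.rev g) := by
  simp [phi, epsilon, hg.fIter_eq]

/-- Iterating the raising operator `n` times adds a multiple of `α i` governed by the running
minimum, and is defined as long as `n` does not exceed `-minVal`. -/
lemma eIter_eq (n : ℕ) {k : ℕ} (hg : K.IsGoodPath i g) (hk : minVal (K.H i g) = -(k : ℝ)) :
    K.eIter i n g = if n ≤ k then
      some fun t => g t + max 0 (minVal (K.H i g) + n - runMin (K.H i g) t) • K.α i else none := by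
  induction n generalizing g k with
  | zero =>
    have h : ∀ t, max 0 (minVal (K.H i g) - runMin (K.H i g) t) = 0 := fun t =>
      max_eq_left (sub_nonpos.2
        (HasIntegralMinima.le_runMin fun r _ => hg.hasIntegralMinima.minVal_le r))
    simp [eIter, h]
  | succ n ih =>
    rw [eIter_succ, hg.eop_eq]
    cases k with
    | zero => simp [hk]
    | succ k =>
      have hN : minVal (K.H i g) ≠ 0 := by
        rw [hk]; exact neg_ne_zero.2 (Nat.cast_ne_zero.2 k.succ_ne_zero)
      obtain ⟨t₀, t₁, -, -, hI⟩ := hg.hasIntegralMinima.exists_isRaiseInterval hN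
      rw [if_neg hN, Option.bind_some, ih (hg.add_raiseCoeff hN) (k := k) (by
        rw [H_add_raiseCoeff, hI.minVal_raise hg.hasIntegralMinima, hk]; push_cast; ring),
        H_add_raiseCoeff, hI.minVal_raise hg.hasIntegralMinima]
      simp only [hI.runMin_raise hg.hasIntegralMinima, add_le_add_iff_right]
      split_ifs with hnk
      · congr 1
        funext t
        rw [add_assoc, ← add_smul]
        congr 2
        rw [raiseCoeff]
        push_cast
        have : (0 : ℝ) ≤ n := n.cast_nonneg
        rcases le_total (runMin (K.H i g) t) (minVal (K.H i g) + 1) with h | h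
        · rw [max_eq_right h, max_eq_right (by linarith), max_eq_right (by linarith),
            max_eq_right (by linarith)]
          ring
        · rw [max_eq_left h, max_eq_left (by linarith), zero_add]
          congr 1
          ring
      · rfl

lemma epsilon_eq {k : ℕ} (hg : K.IsGoodPath i g) (hk : minVal (K.H i g) = -(k : ℝ)) :
    K.epsilon i g = k := by
  have : {n | K.eIter i n g ≠ none} = Set.Iic k := by
    ext n
    simp [hg.eIter_eq n hk]
  rw [epsilon, this, csSup_Iic]

lemma minVal_dilate (m : ℕ) {k : ℕ} (hk : minVal (K.H i g) = -(k : ℝ)) :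
    minVal (K.H i (LSPaper.dilate m g)) = -((m * k : ℕ) : ℝ) := by
  rw [H_dilate, minVal, sInf_image_const_mul, ← minVal, hk]
  push_cast
  ring

lemma epsilon_dilate (hg : K.IsGoodPath i g) {m : ℕ} (hm : 1 ≤ m) :
    K.epsilon i (LSPaper.dilate m g) = m * K.epsilon i g := by
  obtain ⟨k, hk⟩ := hg.hasIntegralMinima.exists_minVal_eq_neg
  rw [(hg.dilate hm).epsilon_eq (minVal_dilate m hk), hg.epsilon_eq hk]

lemma eIter_dilate (hg : K.IsGoodPath i g) {m : ℕ} (hm : 1 ≤ m) :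
    K.eIter i m (LSPaper.dilate m g) = (K.eop i g).map (LSPaper.dilate m) := by
  obtain ⟨k, hk⟩ := hg.hasIntegralMinima.exists_minVal_eq_neg
  have h0 : minVal (K.H i g) = 0 ↔ ¬ m ≤ m * k := by
    rw [hk, neg_eq_zero, Nat.cast_eq_zero, not_le]
    refine ⟨fun h => ?_, fun h => Nat.lt_one_iff.1 ((Nat.mul_lt_mul_left hm).1 (by rwa [mul_one]))⟩
    rw [h, mul_zero]
    exact hm
  rw [(hg.dilate hm).eIter_eq m (minVal_dilate m hk), hg.eop_eq]
  by_cases hN : minVal (K.H i g) = 0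
  · rw [if_neg (h0.1 hN), if_pos hN, Option.map_none]
  · rw [if_pos (not_not.1 (mt h0.2 hN)), if_neg hN, Option.map_some]
    congr 1
    funext t
    simp only [LSPaper.dilate, smul_add, smul_smul, raiseCoeff]
    rw [← LSPaper.dilate, H_dilate, minVal, runMin, sInf_image_const_mul, sInf_image_const_mul,
      ← minVal, ← runMin, mul_max_of_nonneg _ _ m.cast_nonneg]
    ring_nf

lemma phi_dilate (hg : K.IsGoodPath i g) {m : ℕ} (hm : 1 ≤ m) :
    K.phi i (LSPaper.dilate m g) = m * K.phi i g := by
  rw [(hg.dilate hm).phi_eq, hg.phi_eq, rev_dilate, hg.rev.epsilon_dilate hm]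

lemma fIter_dilate (hg : K.IsGoodPath i g) {m : ℕ} (hm : 1 ≤ m) :
    K.fIter i m (LSPaper.dilate m g) = (K.fop i g).map (LSPaper.dilate m) := by
  rw [(hg.dilate hm).fIter_eq, hg.fop_eq, rev_dilate, hg.rev.eIter_dilate hm, Option.map_map,
    Option.map_map]
  congr 1
  funext f
  exact rev_dilate m f

end IsGoodPath

end KacMoodyData

section PiecewiseLinear

lemma nonneg_of_isLocalMin {h : ℝ → ℝ} {t r c : ℝ} (hmin : IsLocalMin h t) (htr : t < r)
    (heq : ∀ x ∈ Set.Icc t r, h x = h t + (x - t) * c) : 0 ≤ c := by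
  obtain ⟨x, hx, hxt, hxr⟩ :=
    ((hmin.filter_mono nhdsWithin_le_nhds).and (Ioc_mem_nhdsGT htr)).exists
  rw [heq x ⟨hxt.le, hxr⟩] at hx
  exact nonneg_of_mul_nonneg_right (by linarith) (sub_pos.2 hxt)

lemma nonpos_of_isLocalMin {h : ℝ → ℝ} {l t c : ℝ} (hmin : IsLocalMin h t) (hlt : l < t)
    (heq : ∀ x ∈ Set.Icc l t, h x = h t + (x - t) * c) : c ≤ 0 := by
  obtain ⟨x, hx, hxl, hxt⟩ :=
    ((hmin.filter_mono nhdsWithin_le_nhds).and (Ico_mem_nhdsLT hlt)).exists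
  rw [heq x ⟨hxl, hxt.le⟩] at hx
  by_contra! hc
  nlinarith [mul_pos (sub_pos.2 hxt) hc]

/-- The piecewise linear function with slope `c k` on `[τ k, τ (k + 1)]` for `k < s`. -/
def piecewiseLinear (s : ℕ) (τ c : ℕ → ℝ) (t : ℝ) : ℝ :=
  ∑ k ∈ Finset.range s, (min t (τ (k + 1)) - min t (τ k)) * c k

variable {s : ℕ} {τ c : ℕ → ℝ}

lemma piecewiseLinear_eq (hτ : Monotone τ) {u : ℕ} (hu : u < s) {t : ℝ} (h₁ : τ u ≤ t)
    (h₂ : t ≤ τ (u + 1)) :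
    piecewiseLinear s τ c t =
      ∑ k ∈ Finset.range u, (τ (k + 1) - τ k) * c k + (t - τ u) * c u := by
  obtain ⟨r, rfl⟩ := Nat.exists_eq_add_of_le (Nat.succ_le_of_lt hu)
  have hz : ∀ x, (min t (τ (u + 1 + x + 1)) - min t (τ (u + 1 + x))) * c (u + 1 + x) = 0 := by
    intro x
    rw [min_eq_left (h₂.trans (hτ (by omega))), min_eq_left (h₂.trans (hτ (by omega))), sub_self,
      zero_mul]
  rw [piecewiseLinear, Nat.succ_eq_add_one, Finset.sum_range_add, Finset.sum_range_succ]
  simp only [hz, Finset.sum_const_zero, add_zero]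
  rw [min_eq_left h₂, min_eq_right h₁]
  congr 1
  refine Finset.sum_congr rfl fun k hk => ?_
  have hk := Finset.mem_range.1 hk
  rw [min_eq_right ((hτ (by omega)).trans h₁), min_eq_right ((hτ hk.le).trans h₁)]

theorem hasIntegralMinima_piecewiseLinear (hs : 0 < s) (hτ : Monotone τ)
    (hlt : ∀ k < s, τ k < τ (k + 1)) (h0 : τ 0 = 0) (h1 : ∀ k, s ≤ k → τ k = 1)
    (hc : ∀ k, ∃ n : ℤ, c k = n)
    (hsub : ∀ u, u + 1 < s → ∃ n : ℤ, τ (u + 1) * (c u - c (u + 1)) = n)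
    (hcross : ∀ u, u + 1 < s → c u ≤ 0 → 0 ≤ c (u + 1) → ∃ n : ℤ, τ (u + 1) * c u = n) :
    HasIntegralMinima (piecewiseLinear s τ c) := by
  have hle1 : ∀ k, τ k ≤ 1 := fun k => (hτ (Nat.le_add_right k s)).trans (h1 _ (by omega)).le
  have hge0 : ∀ k, 0 ≤ τ k := fun k => h0 ▸ hτ k.zero_le
  have hzero : ∀ t ≤ 0, piecewiseLinear s τ c t = 0 := fun t ht =>
    Finset.sum_eq_zero fun k _ => by
      rw [min_eq_left (ht.trans (hge0 _)), min_eq_left (ht.trans (hge0 _)), sub_self, zero_mul]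
  have hone : ∀ t, 1 ≤ t → piecewiseLinear s τ c t = piecewiseLinear s τ c 1 := fun t ht =>
    Finset.sum_congr rfl fun k _ => by
      rw [min_eq_right ((hle1 _).trans ht), min_eq_right ((hle1 _).trans ht),
        min_eq_right (hle1 _), min_eq_right (hle1 _)]
  have hint : ∀ u < s, ∃ n : ℤ,
      ∑ k ∈ Finset.range u, (τ (k + 1) - τ k) * c k - τ u * c u = n := by
    intro u hu
    induction u with
    | zero => exact ⟨0, by simp [h0]⟩
    | succ u ih =>
      obtain ⟨n, hn⟩ := ih (by omega)
      obtain ⟨k, hk⟩ := hsub u hu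
      refine ⟨n + k, ?_⟩
      rw [Finset.sum_range_succ]
      push_cast
      linear_combination hn + hk
  refine ⟨?_, hzero, hone, fun t ht => ?_⟩
  · unfold piecewiseLinear
    fun_prop
  rcases le_or_gt t 0 with ht0 | ht0
  · exact ⟨0, by simp [hzero t ht0]⟩
  rcases le_or_gt 1 t with ht1 | ht1
  · obtain ⟨u, rfl⟩ := Nat.exists_eq_succ_of_ne_zero hs.ne'
    obtain ⟨n, hn⟩ := hint u u.lt_succ_self
    obtain ⟨k, hk⟩ := hc u
    refine ⟨n + k, ?_⟩
    rw [hone t ht1, piecewiseLinear_eq hτ u.lt_succ_self (hle1 _) (h1 _ le_rfl).ge]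
    push_cast
    linear_combination hn + hk
  have hex : ∃ u, t < τ u := ⟨s, (h1 s le_rfl).symm ▸ ht1⟩
  obtain ⟨u, hu⟩ : ∃ u, Nat.find hex = u + 1 :=
    Nat.exists_eq_succ_of_ne_zero fun h => by
      have := Nat.find_spec hex
      rw [h, h0] at this
      linarith
  have htu : t < τ (u + 1) := hu ▸ Nat.find_spec hex
  have hut : τ u ≤ t := not_lt.1 (Nat.find_min hex (by omega))
  have hus : u < s := by
    have := Nat.find_min' hex ((h1 s le_rfl).symm ▸ ht1 : t < τ s)
    omega
  have hr : 0 ≤ c u := nonneg_of_isLocalMin ht htu fun x hx => by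
    rw [piecewiseLinear_eq hτ hus (hut.trans hx.1) hx.2, piecewiseLinear_eq hτ hus hut htu.le]
    ring
  rcases hut.lt_or_eq with hut' | rfl
  · have hl : c u ≤ 0 := nonpos_of_isLocalMin ht hut' fun x hx => by
      rw [piecewiseLinear_eq hτ hus hx.1 (hx.2.trans htu.le),
        piecewiseLinear_eq hτ hus hut htu.le]
      ring
    obtain ⟨n, hn⟩ := hint u hus
    refine ⟨n, ?_⟩
    rw [piecewiseLinear_eq hτ hus hut htu.le, ← hn, le_antisymm hl hr]
    ring
  · obtain ⟨v, rfl⟩ := Nat.exists_eq_succ_of_ne_zero (n := u) fun h => by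
      rw [h, h0] at ht0
      exact lt_irrefl _ ht0
    have hvs : v < s := by omega
    have hv := hlt v hvs
    have hl : c v ≤ 0 := nonpos_of_isLocalMin ht hv fun x hx => by
      rw [piecewiseLinear_eq hτ hvs hx.1 hx.2, piecewiseLinear_eq hτ hvs hv.le le_rfl]
      ring
    obtain ⟨n, hn⟩ := hint v hvs
    obtain ⟨k, hk⟩ := hcross v hus hl hr
    refine ⟨n + k, ?_⟩
    rw [piecewiseLinear_eq hτ hvs hv.le le_rfl]
    push_cast
    linear_combination hn + hk

end PiecewiseLinear

namespace KacMoodyData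

variable {I V : Type*} [Fintype I] [DecidableEq I] [AddCommGroup V] [Module ℝ V]
variable (K : KacMoodyData I V)

lemma weylGroup_apply_mem {w : V ≃ₗ[ℝ] V} (hw : w ∈ K.weylGroup) {x : V} (hx : x ∈ K.P) :
    w x ∈ K.P := by
  obtain ⟨l, rfl⟩ := K.exists_word hw
  clear hw
  induction l with
  | nil => exact hx
  | cons i l ih =>
    obtain ⟨n, hn⟩ := K.pairingInt i _ ih
    rw [wordProd_cons, LinearEquiv.mul_apply, refl_apply, hn, Int.cast_smul_eq_zsmul]
    exact sub_mem ih (zsmul_mem (K.rootMem i) n)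

lemma exists_coroot_eq_intCast_of_mem_orbit {μ ν : V} (hμ : μ ∈ K.P) (hν : ν ∈ K.orbit μ) (i : I) :
    ∃ n : ℤ, K.coroot i ν = n := by
  obtain ⟨w, hw, rfl⟩ := hν
  exact K.pairingInt i _ (K.weylGroup_apply_mem hw hμ)

lemma conj_refl_apply (w : V ≃ₗ[ℝ] V) (j : I) (x : V) :
    w (K.refl j (w.symm x)) = x - K.coroot j (w.symm x) • w (K.α j) := by
  rw [refl_apply, map_sub, map_smul, w.apply_symm_apply]

/-- If a step down of length one takes the pairing with a simple coroot from negative to positive,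
then it is the corresponding simple reflection. -/
lemma root_eq_of_dist_eq_one {w : V ≃ₗ[ℝ] V} (hw : w ∈ K.weylGroup) {i j : I}
    (hpos : w (K.α j) ∈ K.Qplus) {x : V} (hneg : K.coroot j (w.symm x) < 0)
    (hx : K.coroot i x < 0) (hx' : 0 < K.coroot i (w (K.refl j (w.symm x))))
    (hd : K.dist x (w (K.refl j (w.symm x))) = 1) : w (K.α j) = K.α i := by
  by_contra hne
  set y := w (K.refl j (w.symm x)) with hy
  have h3 : K.chainLen 3 x y := by
    refine ⟨fun n => match n with
      | 0 => x
      | 1 => K.refl i x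
      | 2 => K.refl i y
      | _ => y, rfl, rfl, fun q hq => ?_⟩
    interval_cases q
    · exact ⟨1, one_mem _, i, K.root_mem_Qplus i, hx, rfl⟩
    · have hs : (K.refl i * w).symm (K.refl i x) = w.symm x :=
        congrArg w.symm ((K.refl i).symm_apply_apply x)
      refine ⟨K.refl i * w, mul_mem (K.refl_mem i) hw, j, K.refl_mem_Qplus hw hpos hne, ?_, ?_⟩
      · exact hs.symm ▸ hneg
      · change K.refl i y = (K.refl i * w) (K.refl j ((K.refl i * w).symm (K.refl i x)))
        rw [hs, LinearEquiv.mul_apply]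
    · refine ⟨1, one_mem _, i, K.root_mem_Qplus i, ?_, (K.refl_refl i y).symm⟩
      exact (K.coroot_refl_self i y).trans_lt (neg_neg_of_pos hx')
  have hb : BddAbove {p | K.chainLen p x y} := by
    by_contra hb
    rw [dist, Nat.sSup_of_not_bddAbove hb] at hd
    exact zero_ne_one hd
  have := le_csSup hb h3
  rw [← dist, hd] at this
  omega

/-- One step of a `σ`-chain. -/
def SigmaStep (σ : ℚ) (x y : V) : Prop :=
  K.dist x y = 1 ∧ ∃ w ∈ K.weylGroup, ∃ i : I, w (K.α i) ∈ K.Qplus ∧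
    y = w (K.refl i (w.symm x)) ∧ ∃ n : ℤ, n < 0 ∧ (σ : ℝ) * K.coroot i (w.symm x) = (n : ℝ)

variable {K} {σ : ℚ} {x y : V}

lemma SigmaStep.exists_int_sub (h : K.SigmaStep σ x y) (i : I) :
    ∃ n : ℤ, (σ : ℝ) * (K.coroot i x - K.coroot i y) = n := by
  obtain ⟨-, w, -, j, ⟨c, hc⟩, rfl, n, -, hn⟩ := h
  refine ⟨n * ∑ k, c k * K.a i k, ?_⟩
  rw [conj_refl_apply, map_sub, map_smul, sub_sub_cancel, smul_eq_mul, ← mul_assoc, hn, hc]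
  simp [K.cartanPairing]

lemma SigmaStep.exists_int_of_crossing (h : K.SigmaStep σ x y) (hσ : 0 < σ) {i : I}
    (hx : K.coroot i x < 0) (hy : 0 < K.coroot i y) : ∃ n : ℤ, (σ : ℝ) * K.coroot i x = n := by
  obtain ⟨hd, w, hw, j, hpos, rfl, n, hn0, hn⟩ := h
  have hneg : K.coroot j (w.symm x) < 0 := by
    have : (σ : ℝ) * K.coroot j (w.symm x) < 0 := by
      rw [hn]; exact_mod_cast hn0
    exact neg_of_mul_neg_right this (by exact_mod_cast hσ.le)
  have := K.root_eq_of_dist_eq_one hw hpos hneg hx hy hd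
  exact ⟨n, by rw [← hn, K.coroot_symm_of_root_eq hw this]⟩

lemma exists_int_sub_of_sigmaStep {ξ : ℕ → V} {p : ℕ}
    (h : ∀ q < p, K.SigmaStep σ (ξ q) (ξ (q + 1))) (i : I) :
    ∃ n : ℤ, (σ : ℝ) * (K.coroot i (ξ 0) - K.coroot i (ξ p)) = n := by
  induction p with
  | zero => exact ⟨0, by simp⟩
  | succ p ih =>
    obtain ⟨n, hn⟩ := ih fun q hq => h q (by omega)
    obtain ⟨k, hk⟩ := (h p p.lt_succ_self).exists_int_sub i
    exact ⟨n + k, by push_cast; linear_combination hn + hk⟩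

lemma SigmaChain.exists_int_sub (h : K.SigmaChain σ x y) (i : I) :
    ∃ n : ℤ, (σ : ℝ) * (K.coroot i x - K.coroot i y) = n := by
  obtain ⟨p, -, ξ, rfl, rfl, h⟩ := h
  exact exists_int_sub_of_sigmaStep h i

lemma SigmaChain.exists_int_of_crossing (h : K.SigmaChain σ x y) (hσ : 0 < σ) {i : I}
    (hx : K.coroot i x ≤ 0) (hy : 0 ≤ K.coroot i y) : ∃ n : ℤ, (σ : ℝ) * K.coroot i x = n := by
  obtain ⟨p, -, ξ, rfl, rfl, h⟩ := h
  have hex : ∃ q, 0 ≤ K.coroot i (ξ q) := ⟨p, hy⟩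
  have hqp := Nat.find_min' hex hy
  have hq := Nat.find_spec hex
  have hmin := fun q => Nat.find_min hex (m := q)
  generalize Nat.find hex = q at hqp hq hmin
  rcases hq.eq_or_lt with h0 | h0
  · obtain ⟨n, hn⟩ := exists_int_sub_of_sigmaStep (p := q) (fun r hr => h r (by omega)) i
    exact ⟨n, by rw [← hn, ← h0, sub_zero]⟩
  cases q with
  | zero => exact absurd h0 hx.not_gt
  | succ q =>
    obtain ⟨n, hn⟩ := exists_int_sub_of_sigmaStep (p := q) (fun r hr => h r (by omega)) i
    obtain ⟨k, hk⟩ := SigmaStep.exists_int_of_crossing (h q (by omega)) hσ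
      (not_le.1 (hmin q q.lt_succ_self)) h0
    exact ⟨n + k, by push_cast; linear_combination hn + hk⟩

lemma LSData.H_path {μ : V} (π : K.LSData μ) (i : I) :
    K.H i π.path = piecewiseLinear π.s
      (fun k => (π.τ ⟨min k π.s, Nat.lt_succ_of_le (min_le_right _ _)⟩ : ℝ))
      (fun k => K.coroot i (π.ν ⟨min k (π.s - 1), by have := π.spos; omega⟩)) := by
  funext t
  simp only [H, path, map_sum, map_smul, smul_eq_mul, piecewiseLinear]
  rw [← Fin.sum_univ_eq_sum_range (fun k =>
    (min t (π.τ ⟨min (k + 1) π.s, Nat.lt_succ_of_le (min_le_right _ _)⟩ : ℝ) -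
      min t (π.τ ⟨min k π.s, Nat.lt_succ_of_le (min_le_right _ _)⟩ : ℝ)) *
      K.coroot i (π.ν ⟨min k (π.s - 1), by have := π.spos; omega⟩))]
  refine Finset.sum_congr rfl fun k _ => ?_
  have hk := k.isLt
  congr
  · exact Fin.ext (min_eq_left (Nat.succ_le_of_lt hk)).symm
  · exact Fin.ext (min_eq_left hk.le).symm
  · exact Fin.ext (min_eq_left (Nat.le_sub_one_of_lt hk)).symm

theorem isGoodPath_of_mem_B {μ : V} (hμ : μ ∈ K.P) {f : ℝ → V} (hf : f ∈ K.B μ) (i : I) :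
    K.IsGoodPath i f := by
  obtain ⟨π, rfl⟩ := hf
  have hτ0 : ∀ u, 0 ≤ π.τ u := fun u => π.τ_zero ▸ π.τ_mono.monotone (Fin.zero_le u)
  refine ⟨?_, Finset.sum_eq_zero fun k _ => ?_⟩
  · rw [π.H_path]
    have hs := π.spos
    refine hasIntegralMinima_piecewiseLinear hs (fun k l hkl => ?_) (fun k hk => ?_) ?_
      (fun k hk => ?_) (fun k => K.exists_coroot_eq_intCast_of_mem_orbit hμ (π.mem _) i)
      (fun u hu => ?_) (fun u hu h₁ h₂ => ?_)
    · exact_mod_cast π.τ_mono.monotone (Fin.mk_le_mk.2 (min_le_min_right _ hkl))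
    · refine Rat.cast_lt.2 (π.τ_mono (Fin.mk_lt_mk.2 ?_))
      omega
    · simp only [Nat.zero_min]
      exact_mod_cast π.τ_zero
    · simp only [min_eq_right hk]
      exact_mod_cast π.τ_last
    all_goals
      have e₁ : min (u + 1) π.s = u + 1 := by omega
      have e₂ : min u (π.s - 1) = u := by omega
      have e₃ : min (u + 1) (π.s - 1) = u + 1 := by omega
      simp only [e₁, e₂, e₃] at *
    · exact (π.chainCond u hu).exists_int_sub i
    · refine (π.chainCond u hu).exists_int_of_crossing ?_ h₁ h₂
      rw [← π.τ_zero]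
      exact π.τ_mono (Fin.mk_lt_mk.2 u.succ_pos)
  · have h : ∀ u, min (0 : ℝ) (π.τ u) = 0 := fun u => min_eq_left (by exact_mod_cast hτ0 u)
    rw [h, h, sub_self, zero_smul]

end KacMoodyData

end LSPaper

open LSPaper in
theorem statement7 {I V : Type*} [Fintype I] [DecidableEq I] [AddCommGroup V] [Module ℝ V]
    (K : KacMoodyData I V) (μ : V) (hμ : μ ∈ K.P)
    (m : ℕ) (hm : 1 ≤ m) :
    dilate m (straight μ) = straight ((m : ℝ) • μ) ∧
    (∀ f ∈ K.B μ, (dilate m f) 1 = (m : ℝ) • f 1) ∧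
    (∀ f ∈ K.B μ, ∀ i : I,
      K.eIter i m (dilate m f) = (K.eop i f).map (dilate m) ∧
      K.fIter i m (dilate m f) = (K.fop i f).map (dilate m)) ∧
    (∀ f ∈ K.B μ, ∀ i : I,
      K.epsilon i (dilate m f) = m * K.epsilon i f ∧
      K.phi i (dilate m f) = m * K.phi i f) := by
  have hgood := fun f (hf : f ∈ K.B μ) i => KacMoodyData.isGoodPath_of_mem_B hμ hf i
  exact ⟨funext fun t => smul_comm _ _ _, fun _ _ => rfl,
    fun f hf i => ⟨(hgood f hf i).eIter_dilate hm, (hgood f hf i).fIter_dilate hm⟩,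
    fun f hf i => ⟨(hgood f hf i).epsilon_dilate hm, (hgood f hf i).phi_dilate hm⟩⟩
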